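/- There exists a constant D ≥ 1 such that for every ξ ∈ ∂Γ, every geodesic ray {x(n)}_{n≥0} ∈ [e,ξ], and every R ∈ ℕ, one has 1/D ≤ ν(U(ξ,R)) / F(e,x(R)) ≤ D. (The harmonic measure of the boundary cylinder U(ξ,R) is comparable, with uniform constants, to the probability that the random walk from e hits the point x(R).) -/

import Mathlib

open Filter Topology MeasureTheory
open scoped ENNReal

namespace HarmonicBoundary

variable {Γ : Type} [Group Γ]

/-- Word length of `g` with respect to a generating set `S`. -/
noncomputable def wl (S : Set Γ) (g : Γ) : ℕ :=
  sInf {n : ℕ | ∃ w : List Γ, w.length = n ∧ (∀ x ∈ w, x ∈ S) ∧ w.prod = g}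

/-- Word metric `d(x,y) = |x⁻¹y|`. -/
noncomputable def wdist (S : Set Γ) (x y : Γ) : ℕ := wl S (x⁻¹ * y)

/-- Gromov product `(x|y)_z = (d(x,z)+d(y,z)-d(x,y))/2`. -/
noncomputable def gp (S : Set Γ) (z x y : Γ) : ℝ :=
  ((wdist S x z : ℝ) + (wdist S y z : ℝ) - (wdist S x y : ℝ)) / 2

/-- `S` is a finite symmetric generating set of `Γ`. -/
def IsGenSet (S : Set Γ) : Prop :=
  S.Finite ∧ (∀ s ∈ S, s⁻¹ ∈ S) ∧ Subgroup.closure S = ⊤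

/-- `Γ` is `δ`-hyperbolic with respect to the word metric of `S`:
`(x|y) ≥ min ((x|z), (y|z)) - δ` for all `x y z`. -/
def IsHyperbolic (S : Set Γ) (δ : ℝ) : Prop :=
  0 ≤ δ ∧ ∀ x y z : Γ, min (gp S 1 x z) (gp S 1 y z) - δ ≤ gp S 1 x y

/-- `Γ` is nonelementary: it has no cyclic subgroup of finite index. -/
def Nonelementary (Γ : Type) [Group Γ] : Prop :=
  ∀ g : Γ, (Subgroup.zpowers g).index = 0

/-- A sequence converges to infinity if `(x_i|x_j) → ∞`. -/
def ConvInf (S : Set Γ) (u : ℕ → Γ) : Prop :=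
  Tendsto (fun p : ℕ × ℕ => gp S 1 (u p.1) (u p.2)) atTop atTop

/-- Two sequences converging to infinity are equivalent if `(x_i|y_j) → ∞`. -/
def EquivSeq (S : Set Γ) (u v : ℕ → Γ) : Prop :=
  Tendsto (fun p : ℕ × ℕ => gp S 1 (u p.1) (v p.2)) atTop atTop

/-- An (abstract model of the) Gromov boundary of `Γ`: the points are exactly the
classes of sequences converging to infinity, modulo the equivalence `EquivSeq`,
together with the natural left action of `Γ`. -/
structure Boundary (Γ : Type) [Group Γ] (S : Set Γ) where
  pt : Type
  cls : (ℕ → Γ) → pt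
  cls_surj : ∀ ξ : pt, ∃ u : ℕ → Γ, ConvInf S u ∧ cls u = ξ
  cls_eq : ∀ u v : ℕ → Γ, ConvInf S u → ConvInf S v → (cls u = cls v ↔ EquivSeq S u v)
  smul : Γ → pt → pt
  smul_cls : ∀ (g : Γ) (u : ℕ → Γ), ConvInf S u → smul g (cls u) = cls fun n => g * u n

/-- Extension of the Gromov product to the boundary:
`(ξ|η) = sup liminf (x_i|y_j)` over sequences representing `ξ` and `η`,
as an extended nonnegative real. -/
noncomputable def bgp {S : Set Γ} (B : Boundary Γ S) (ξ η : B.pt) : ℝ≥0∞ :=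
  ⨆ (u : {u : ℕ → Γ // ConvInf S u ∧ B.cls u = ξ})
    (v : {v : ℕ → Γ // ConvInf S v ∧ B.cls v = η}),
    Filter.liminf (fun p : ℕ × ℕ => ENNReal.ofReal (gp S 1 (u.1 p.1) (v.1 p.2))) atTop

/-- Real-valued Gromov product on the boundary (finite for `ξ ≠ η`). -/
noncomputable def bgpR {S : Set Γ} (B : Boundary Γ S) (ξ η : B.pt) : ℝ := (bgp B ξ η).toReal

/-- The canonical topology of the Gromov boundary: a set is open iff around each of
its points it contains a basic neighbourhood `V_r(p) = {q | (q|p) > r}`. -/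
def btop {S : Set Γ} (B : Boundary Γ S) : TopologicalSpace B.pt where
  IsOpen O := ∀ p ∈ O, ∃ r : ℝ≥0∞, r ≠ ⊤ ∧ {q | r < bgp B q p} ⊆ O
  isOpen_univ := fun p _ => ⟨0, ENNReal.zero_ne_top, fun q _ => trivial⟩
  isOpen_inter := by
    intro A A' hA hA' p hp
    obtain ⟨r1, hr1, h1⟩ := hA p hp.1
    obtain ⟨r2, hr2, h2⟩ := hA' p hp.2
    refine ⟨max r1 r2, (max_lt hr1.lt_top hr2.lt_top).ne, fun q hq => ?_⟩
    have hq' : max r1 r2 < bgp B q p := hq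
    exact ⟨h1 (show r1 < bgp B q p from (le_max_left r1 r2).trans_lt hq'),
      h2 (show r2 < bgp B q p from (le_max_right r1 r2).trans_lt hq')⟩
  isOpen_sUnion := by
    intro s hs p hp
    obtain ⟨t, ht, hpt⟩ := hp
    obtain ⟨r, hr, hsub⟩ := hs t ht p hpt
    exact ⟨r, hr, fun q hq => ⟨t, ht, hsub hq⟩⟩

/-- The attracting fixed point `g⁺ = lim_n gⁿ` of an (infinite order) element. -/
def plusPt {S : Set Γ} (B : Boundary Γ S) (g : Γ) : B.pt := B.cls fun n => g ^ n

/-- The repelling fixed point `g⁻ = lim_n g⁻ⁿ` of an (infinite order) element. -/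
def minusPt {S : Set Γ} (B : Boundary Γ S) (g : Γ) : B.pt := B.cls fun n => g⁻¹ ^ n

/-- A geodesic ray starting at the identity. -/
def IsGeodesicRay (S : Set Γ) (x : ℕ → Γ) : Prop :=
  x 0 = 1 ∧ ∀ m n : ℕ, wdist S (x m) (x n) = Nat.dist m n

/-- A geodesic ray from `e` to the boundary point `ξ`, i.e. an element of `[e,ξ]`. -/
def RayTo {S : Set Γ} (B : Boundary Γ S) (x : ℕ → Γ) (ξ : B.pt) : Prop :=
  IsGeodesicRay S x ∧ ConvInf S x ∧ B.cls x = ξ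

/-- A geodesic segment from `x` to `y` (parametrized on `0,…,d(x,y)`),
i.e. an element of `[x,y]`. -/
def IsGeodesicSeg (S : Set Γ) (x y : Γ) (α : ℕ → Γ) : Prop :=
  α 0 = x ∧ α (wdist S x y) = y ∧
  ∀ m n : ℕ, m ≤ wdist S x y → n ≤ wdist S x y → wdist S (α m) (α n) = Nat.dist m n

/-- The boundary "cylinder" `U(ξ,R)`: all `η` such that for every pair of geodesic
rays `x ∈ [e,ξ]`, `y ∈ [e,η]` one has `lim_n (x(n)|y(n)) > R` (the sequence
`(x(n)|y(n))` is nondecreasing, so the limit exceeds `R` iff some term does). -/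
def Uset {S : Set Γ} (B : Boundary Γ S) (ξ : B.pt) (R : ℝ) : Set B.pt :=
  {η | ∀ x y : ℕ → Γ, RayTo B x ξ → RayTo B y η → ∃ n : ℕ, R < gp S 1 (x n) (y n)}

/-- `C_r(p) = {g | (g|e)_p > r}`. -/
def Cset (S : Set Γ) (p : Γ) (r : ℝ) : Set Γ := {g | r < gp S p g 1}

/-- The `R`-neighbourhood `N(α,R)` of a geodesic segment `α ∈ [x,y]`. -/
def segN (S : Set Γ) (x y : Γ) (α : ℕ → Γ) (R : ℝ) : Set Γ :=
  {g | ∃ i ≤ wdist S x y, (wdist S g (α i) : ℝ) ≤ R}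

/-- The `R`-neighbourhood `N(A,R)` of a subset `A ⊆ Γ`. -/
def setN (S : Set Γ) (A : Set Γ) (R : ℝ) : Set Γ :=
  {g | ∃ a ∈ A, (wdist S g a : ℝ) ≤ R}

/-- `μ` is a nondegenerate probability measure on `Γ` with support contained in `S`:
nonnegative, of total mass one, supported in `S`, and the semigroup generated by its
support is the whole of `Γ`. -/
structure IsRWMeasure (S : Set Γ) (μ : Γ → ℝ) : Prop where
  nonneg : ∀ g, 0 ≤ μ g
  support_subset : ∀ g, μ g ≠ 0 → g ∈ S
  total : ∑' g : Γ, μ g = 1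
  nondeg : ∀ g : Γ, ∃ l : List Γ, l ≠ [] ∧ (∀ x ∈ l, 0 < μ x) ∧ l.prod = g

open Classical in
/-- `n`-step transition probabilities `p⁽ⁿ⁾(x,y) = μ*ⁿ(x⁻¹y)` of the random walk. -/
noncomputable def ptrans (μ : Γ → ℝ) : ℕ → Γ → Γ → ℝ
  | 0 => fun x y => if x = y then 1 else 0
  | n + 1 => fun x y => ∑' z : Γ, ptrans μ n x z * μ (z⁻¹ * y)

/-- Green function `G(x,y) = Σ_n p⁽ⁿ⁾(x,y)`. -/
noncomputable def green (μ : Γ → ℝ) (x y : Γ) : ℝ := ∑' n : ℕ, ptrans μ n x y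

/-- `F(x,y) = G(x,y)/G(y,y)`, the probability that the walk from `x` ever hits `y`. -/
noncomputable def greenF (μ : Γ → ℝ) (x y : Γ) : ℝ := green μ x y / green μ y y

/-- The Martin kernel `K(x,y) = G(x,y)/G(e,y)`. -/
noncomputable def martinK (μ : Γ → ℝ) (x y : Γ) : ℝ := green μ x y / green μ 1 y

open Classical in
/-- Transition probabilities of the walk restricted to `Δ` (killed when leaving `Δ`). -/
noncomputable def ptransR (μ : Γ → ℝ) (Δ : Set Γ) : ℕ → Γ → Γ → ℝ
  | 0 => fun x y => if x = y ∧ x ∈ Δ then 1 else 0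
  | n + 1 => fun x y => if y ∈ Δ then ∑' z : Γ, ptransR μ Δ n x z * μ (z⁻¹ * y) else 0

/-- Green function `G_Δ` of the restricted walk. -/
noncomputable def greenR (μ : Γ → ℝ) (Δ : Set Γ) (x y : Γ) : ℝ := ∑' n : ℕ, ptransR μ Δ n x y

/-- `F_Δ(x,y) = G_Δ(x,y)/G_Δ(y,y)`. -/
noncomputable def greenFR (μ : Γ → ℝ) (Δ : Set Γ) (x y : Γ) : ℝ :=
  greenR μ Δ x y / greenR μ Δ y y

/-- Generating function `G_Δ(x,y|z) = Σ_n p_Δ⁽ⁿ⁾(x,y) zⁿ`. -/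
noncomputable def greenRZ (μ : Γ → ℝ) (Δ : Set Γ) (x y : Γ) (z : ℝ) : ℝ :=
  ∑' n : ℕ, ptransR μ Δ n x y * z ^ n

/-- Spectral radius `ρ(P) = lim_n p⁽ⁿ⁾(e,e)^{1/n}` of the walk. -/
noncomputable def specRad (μ : Γ → ℝ) : ℝ :=
  Filter.limsup (fun n : ℕ => (ptrans μ n 1 1) ^ ((n : ℝ)⁻¹)) atTop

/-- `u` is harmonic on `Λ`: `Σ_h p(g,h) u(h) = u(g)` for `g ∈ Λ`, `p(g,h)=μ(g⁻¹h)`. -/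
def HarmonicOn (μ : Γ → ℝ) (u : Γ → ℝ) (Λ : Set Γ) : Prop :=
  ∀ g ∈ Λ, (∑' h : Γ, μ (g⁻¹ * h) * u h) = u g

/-- `u` vanishes at infinity on `Λ`: `u(g_n) → 0` along sequences in `Λ` with `|g_n|→∞`. -/
def VanishesAtInftyOn (S : Set Γ) (u : Γ → ℝ) (Λ : Set Γ) : Prop :=
  ∀ ε : ℝ, 0 < ε → ∃ M : ℕ, ∀ g ∈ Λ, M ≤ wl S g → |u g| ≤ ε

open Classical in
/-- `r(g) = K(g⁻¹,g⁺)` for infinite order `g`, and `r(g) = 1` for finite order `g`;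
here `Kb` is the boundary extension of the Martin kernel. -/
noncomputable def rfun {S : Set Γ} (B : Boundary Γ S) (Kb : Γ → B.pt → ℝ) (g : Γ) : ℝ :=
  if IsOfFinOrder g then 1 else Kb g⁻¹ (plusPt B g)

/-- The ratio set `r(Γ,∂Γ,ν)`: all `l ≥ 0` such that for every `ε > 0` and every
Borel `A` of positive measure there is `g ∈ Γ` such that
`{ω ∈ gA ∩ A : |d(gν)/dν(ω) − l| < ε}` has positive measure; here the
Radon–Nikodym derivative `d(gν)/dν` is the Martin kernel `Kb g`. -/
def ratioSet {S : Set Γ} (B : Boundary Γ S) [MeasurableSpace B.pt]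
    (ν : Measure B.pt) (Kb : Γ → B.pt → ℝ) : Set ℝ :=
  {l : ℝ | 0 ≤ l ∧ ∀ ε : ℝ, 0 < ε → ∀ A : Set B.pt, MeasurableSet A → 0 < ν A →
    ∃ g : Γ, 0 < ν {ω | ω ∈ A ∧ B.smul g⁻¹ ω ∈ A ∧ |Kb g ω - l| < ε}}

/-- A left invariant finitely additive mean on `Γ`; `Γ` is amenable iff one exists. -/
structure InvariantMean (Γ : Type) [Group Γ] where
  m : Set Γ → ℝ
  nonneg : ∀ A, 0 ≤ m A
  total : m Set.univ = 1
  fin_add : ∀ A B : Set Γ, Disjoint A B → m (A ∪ B) = m A + m B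
  invariant : ∀ (g : Γ) (A : Set Γ), m ((g * ·) ⁻¹' A) = m A


section

/-! ### Word metric -/

lemma exists_word {S : Set Γ} (hS : IsGenSet S) (g : Γ) :
    ∃ w : List Γ, (∀ x ∈ w, x ∈ S) ∧ w.prod = g := by
  have hg : g ∈ Subgroup.closure S := by rw [hS.2.2]; trivial
  induction hg using Subgroup.closure_induction with
  | mem x hx => exact ⟨[x], by simpa using hx, by simp⟩
  | one => exact ⟨[], by simp, by simp⟩
  | mul x y _ _ hx hy =>
    obtain ⟨w, hw, rfl⟩ := hx
    obtain ⟨v, hv, rfl⟩ := hy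
    refine ⟨w ++ v, ?_, by simp⟩
    intro z hz
    rcases List.mem_append.1 hz with h | h
    · exact hw z h
    · exact hv z h
  | inv x _ hx =>
    obtain ⟨w, hw, rfl⟩ := hx
    refine ⟨(w.map (·⁻¹)).reverse, ?_, by rw [List.prod_inv_reverse]⟩
    intro z hz
    simp only [List.mem_reverse, List.mem_map] at hz
    obtain ⟨a, ha, rfl⟩ := hz
    exact hS.2.1 a (hw a ha)

lemma exists_geod_word {S : Set Γ} (hS : IsGenSet S) (g : Γ) :
    ∃ w : List Γ, w.length = wl S g ∧ (∀ x ∈ w, x ∈ S) ∧ w.prod = g := by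
  have : (wl S g) ∈ {n : ℕ | ∃ w : List Γ, w.length = n ∧ (∀ x ∈ w, x ∈ S) ∧ w.prod = g} := by
    apply Nat.sInf_mem
    obtain ⟨w, h1, h2⟩ := exists_word hS g
    exact ⟨w.length, w, rfl, h1, h2⟩
  exact this

lemma wl_le_length {S : Set Γ} (w : List Γ) (hw : ∀ x ∈ w, x ∈ S) : wl S w.prod ≤ w.length :=
  Nat.sInf_le ⟨w, rfl, hw, rfl⟩

lemma wl_one (S : Set Γ) : wl S 1 = 0 := by
  have := wl_le_length (S := S) ([] : List Γ) (by simp)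
  simpa using this

lemma wl_mul_le {S : Set Γ} (hS : IsGenSet S) (g h : Γ) : wl S (g * h) ≤ wl S g + wl S h := by
  obtain ⟨w, hw1, hw2, hw3⟩ := exists_geod_word hS g
  obtain ⟨v, hv1, hv2, hv3⟩ := exists_geod_word hS h
  have := wl_le_length (S := S) (w ++ v) (by
    intro z hz
    rcases List.mem_append.1 hz with h | h
    · exact hw2 z h
    · exact hv2 z h)
  simpa [hw3, hv3, hw1, hv1] using this

lemma wl_inv_le {S : Set Γ} (hS : IsGenSet S) (g : Γ) : wl S g⁻¹ ≤ wl S g := by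
  obtain ⟨w, hw1, hw2, hw3⟩ := exists_geod_word hS g
  have := wl_le_length (S := S) ((w.map (·⁻¹)).reverse) (by
    intro z hz
    simp only [List.mem_reverse, List.mem_map] at hz
    obtain ⟨a, ha, rfl⟩ := hz
    exact hS.2.1 a (hw2 a ha))
  rw [← List.prod_inv_reverse, hw3] at this
  simpa [hw1] using this

lemma wl_inv {S : Set Γ} (hS : IsGenSet S) (g : Γ) : wl S g⁻¹ = wl S g :=
  le_antisymm (wl_inv_le hS g) (by simpa using wl_inv_le hS g⁻¹)

lemma wl_gen {S : Set Γ} {s : Γ} (hs : s ∈ S) : wl S s ≤ 1 := by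
  simpa using wl_le_length (S := S) [s] (by simpa using hs)

lemma wl_eq_zero {S : Set Γ} (hS : IsGenSet S) {g : Γ} (h : wl S g = 0) : g = 1 := by
  obtain ⟨w, hw1, hw2, hw3⟩ := exists_geod_word hS g
  rw [h] at hw1
  rw [List.length_eq_zero_iff] at hw1
  simp [← hw3, hw1]

lemma wdist_self (S : Set Γ) (x : Γ) : wdist S x x = 0 := by simp [wdist, wl_one]

lemma wdist_comm {S : Set Γ} (hS : IsGenSet S) (x y : Γ) : wdist S x y = wdist S y x := by
  rw [wdist, wdist, ← wl_inv hS]; simp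

lemma wdist_tri {S : Set Γ} (hS : IsGenSet S) (x y z : Γ) :
    wdist S x z ≤ wdist S x y + wdist S y z := by
  have := wl_mul_le hS (x⁻¹ * y) (y⁻¹ * z)
  simpa [wdist, mul_assoc] using this

lemma wdist_left (S : Set Γ) (g x y : Γ) : wdist S (g * x) (g * y) = wdist S x y := by
  simp [wdist, mul_assoc]

lemma wdist_eq_zero {S : Set Γ} (hS : IsGenSet S) {x y : Γ} (h : wdist S x y = 0) : x = y := by
  have := wl_eq_zero hS h
  exact (inv_mul_eq_one.1 this)

lemma wdist_one (S : Set Γ) (x : Γ) : wdist S 1 x = wl S x := by simp [wdist]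

lemma wdist_mul_gen {S : Set Γ} {s : Γ} (hs : s ∈ S) (x : Γ) : wdist S x (x * s) ≤ 1 := by
  simpa [wdist] using wl_gen hs

lemma wball_finite {S : Set Γ} (hS : IsGenSet S) (n : ℕ) : {g : Γ | wl S g ≤ n}.Finite := by
  induction n with
  | zero =>
    apply Set.Finite.subset (Set.finite_singleton (1 : Γ))
    intro g hg
    exact wl_eq_zero hS (Nat.le_zero.1 hg)
  | succ n ih =>
    apply Set.Finite.subset ((ih.union (ih.image2 (· * ·) hS.1)))
    intro g hg
    by_cases hn : wl S g ≤ n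
    · exact Or.inl hn
    right
    have hg' : wl S g = n + 1 := by
      have : wl S g ≤ n + 1 := hg
      omega
    obtain ⟨w, hw1, hw2, hw3⟩ := exists_geod_word hS g
    rcases List.eq_nil_or_concat w with rfl | ⟨v, s, rfl⟩
    · simp at hw1; omega
    · simp only [List.concat_eq_append] at *
      refine ⟨v.prod, ?_, s, hw2 s (by simp), by simpa using hw3⟩
      have := wl_le_length (S := S) v (fun x hx => hw2 x (by simp [hx]))
      simp at hw1
      show wl S v.prod ≤ n
      omega

lemma wdist_ball_finite {S : Set Γ} (hS : IsGenSet S) (x : Γ) (n : ℕ) :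
    {g : Γ | wdist S x g ≤ n}.Finite := by
  have := (wball_finite hS n).image (x * ·)
  apply this.subset
  intro g hg
  exact ⟨x⁻¹ * g, hg, by simp⟩

/-- Geodesic from `1` to `g`. -/
lemma exists_geod {S : Set Γ} (hS : IsGenSet S) (g : Γ) :
    ∃ α : ℕ → Γ, α 0 = 1 ∧ (∀ m, wl S g ≤ m → α m = g) ∧
      (∀ m n, m ≤ wl S g → n ≤ wl S g → wdist S (α m) (α n) = Nat.dist m n) := by
  obtain ⟨w, hw1, hw2, hw3⟩ := exists_geod_word hS g
  have hend : ∀ m, wl S g ≤ m → (w.take m).prod = g := by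
    intro m hm
    rw [List.take_of_length_le (by omega), hw3]
  have key : ∀ m k, wdist S (w.take m).prod (w.take (m + k)).prod ≤ k := by
    intro m k
    have : (w.take m).prod⁻¹ * (w.take (m + k)).prod = ((w.drop m).take k).prod := by
      rw [List.take_add, List.prod_append]; simp
    rw [wdist, this]
    refine (wl_le_length _ ?_).trans (by simp)
    intro x hx
    exact hw2 x (List.mem_of_mem_drop (List.mem_of_mem_take hx))
  have h0 : (w.take 0).prod = 1 := by simp
  have key2 : ∀ m k, m + k ≤ wl S g →
      wdist S (w.take m).prod (w.take (m + k)).prod = k := by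
    intro m k hmk
    apply le_antisymm (key m k)
    have h1 := key 0 m
    have h2 := key (m + k) (wl S g - (m + k))
    rw [Nat.add_sub_cancel' hmk] at h2
    have h3 := wdist_tri hS (w.take 0).prod (w.take (0+m)).prod (w.take (wl S g)).prod
    have h4 := wdist_tri hS (w.take m).prod (w.take (m+k)).prod (w.take (wl S g)).prod
    rw [hend _ le_rfl] at *
    rw [h0, wdist_one] at h3
    simp only [zero_add] at *
    rw [h0] at h1
    omega
  refine ⟨fun m => (w.take m).prod, h0, hend, ?_⟩
  intro m n hm hn
  rcases le_total m n with h | h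
  · obtain ⟨k, rfl⟩ := Nat.exists_eq_add_of_le h
    simp only
    rw [key2 m k hn, Nat.dist_eq_sub_of_le h]; omega
  · obtain ⟨k, rfl⟩ := Nat.exists_eq_add_of_le h
    simp only
    rw [wdist_comm hS, key2 n k hm, Nat.dist_eq_sub_of_le_right h]; omega

/-! ### Gromov products -/

lemma gp_comm {S : Set Γ} (hS : IsGenSet S) (z x y : Γ) : gp S z x y = gp S z y x := by
  unfold gp; rw [wdist_comm hS x y]; ring

lemma gp_left (S : Set Γ) (g z x y : Γ) : gp S (g * z) (g * x) (g * y) = gp S z x y := by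
  simp [gp, wdist_left]

lemma gp_base (S : Set Γ) (z x y : Γ) : gp S z x y = gp S 1 (z⁻¹ * x) (z⁻¹ * y) := by
  rw [← gp_left S z⁻¹ z x y]; simp

lemma hyp {S : Set Γ} {δ : ℝ} (hS : IsGenSet S) (hδ : IsHyperbolic S δ) (q x y z : Γ) :
    min (gp S q x y) (gp S q y z) - δ ≤ gp S q x z := by
  have := hδ.2 (q⁻¹ * x) (q⁻¹ * z) (q⁻¹ * y)
  rw [gp_base S q x y, gp_base S q y z, gp_base S q x z, gp_comm hS 1 (q⁻¹ * y)]
  exact this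

/-- if both products are at least `t` -/
lemma hyp_ge {S : Set Γ} {δ : ℝ} (hS : IsGenSet S) (hδ : IsHyperbolic S δ) (q x y z : Γ) (t : ℝ)
    (h1 : t ≤ gp S q x y) (h2 : t ≤ gp S q y z) : t - δ ≤ gp S q x z :=
  le_trans (by have := le_min h1 h2; linarith) (hyp hS hδ q x y z)

lemma gp_nonneg {S : Set Γ} (hS : IsGenSet S) (z x y : Γ) : 0 ≤ gp S z x y := by
  unfold gp
  have := wdist_tri hS x z y
  rw [wdist_comm hS z y] at this
  have : (wdist S x y : ℝ) ≤ wdist S x z + wdist S y z := by exact_mod_cast this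
  linarith

lemma gp_le_left {S : Set Γ} (hS : IsGenSet S) (z x y : Γ) : gp S z x y ≤ wdist S x z := by
  unfold gp
  have := wdist_tri hS y x z
  rw [wdist_comm hS y x] at this
  have : (wdist S y z : ℝ) ≤ wdist S x y + wdist S x z := by exact_mod_cast this
  linarith

lemma gp_le_right {S : Set Γ} (hS : IsGenSet S) (z x y : Γ) : gp S z x y ≤ wdist S y z := by
  rw [gp_comm hS]; exact gp_le_left hS z y x

/-- change of base point formula -/
lemma gp_change {S : Set Γ} (hS : IsGenSet S) (y q a b : Γ) :
    gp S y a b = wdist S y q + gp S q a b - gp S q a y - gp S q b y := by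
  unfold gp; rw [wdist_comm hS a y, wdist_comm hS b y]; ring

lemma gp_swap {S : Set Γ} (hS : IsGenSet S) (y q b : Γ) :
    gp S y q b = wdist S y q - gp S q y b := by
  unfold gp; rw [wdist_comm hS b y, wdist_comm hS q y, wdist_comm hS q b]; ring

/-- Lipschitz in the second entry -/
lemma gp_lip {S : Set Γ} (hS : IsGenSet S) (z x y y' : Γ) :
    gp S z x y ≤ gp S z x y' + wdist S y y' := by
  unfold gp
  have h1 := wdist_tri hS y y' z
  have h2 := wdist_tri hS x y y'
  have h1' : (wdist S y z : ℝ) ≤ wdist S y y' + wdist S y' z := by exact_mod_cast h1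
  have h2' : (wdist S x y' : ℝ) ≤ wdist S x y + wdist S y y' := by exact_mod_cast h2
  linarith

/-- Lipschitz in the base point -/
lemma gp_lip_base {S : Set Γ} (hS : IsGenSet S) (z z' x y : Γ) :
    gp S z x y ≤ gp S z' x y + wdist S z z' := by
  unfold gp
  have h1 := wdist_tri hS x z' z
  have h2 := wdist_tri hS y z' z
  rw [wdist_comm hS z' z] at h1 h2
  have h1' : (wdist S x z : ℝ) ≤ wdist S x z' + wdist S z z' := by exact_mod_cast h1
  have h2' : (wdist S y z : ℝ) ≤ wdist S y z' + wdist S z z' := by exact_mod_cast h2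
  linarith

lemma gp_self {S : Set Γ} (z x : Γ) : gp S z x x = wdist S x z := by
  unfold gp; rw [wdist_self]; push_cast; ring

end

section

/-! ### Sequences converging to infinity -/

lemma equivSeq_iff {S : Set Γ} (u v : ℕ → Γ) :
    EquivSeq S u v ↔ ∀ C : ℝ, ∃ N, ∀ i ≥ N, ∀ j ≥ N, C ≤ gp S 1 (u i) (v j) := by
  unfold EquivSeq
  rw [tendsto_atTop]
  refine forall_congr' fun C => ?_
  rw [eventually_atTop]
  constructor
  · rintro ⟨⟨a, b⟩, h⟩
    exact ⟨max a b, fun i hi j hj => h (i, j) ⟨le_trans (le_max_left _ _) hi,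
      le_trans (le_max_right _ _) hj⟩⟩
  · rintro ⟨N, h⟩
    exact ⟨(N, N), fun p hp => h p.1 hp.1 p.2 hp.2⟩

lemma convInf_iff {S : Set Γ} (u : ℕ → Γ) :
    ConvInf S u ↔ ∀ C : ℝ, ∃ N, ∀ i ≥ N, ∀ j ≥ N, C ≤ gp S 1 (u i) (u j) :=
  equivSeq_iff u u

lemma equivSeq_base {S : Set Γ} (hS : IsGenSet S) {u v : ℕ → Γ} (h : EquivSeq S u v) (g : Γ) (C : ℝ) :
    ∃ N, ∀ i ≥ N, ∀ j ≥ N, C ≤ gp S g (u i) (v j) := by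
  obtain ⟨N, hN⟩ := (equivSeq_iff u v).1 h (C + wdist S 1 g)
  refine ⟨N, fun i hi j hj => ?_⟩
  have := gp_lip_base hS 1 g (u i) (v j)
  linarith [hN i hi j hj]

lemma equivSeq_mul {S : Set Γ} (hS : IsGenSet S) {u v : ℕ → Γ} (h : EquivSeq S u v) (g : Γ) :
    EquivSeq S (fun n => g * u n) (fun n => g * v n) := by
  rw [equivSeq_iff]
  intro C
  obtain ⟨N, hN⟩ := equivSeq_base hS h g⁻¹ C
  refine ⟨N, fun i hi j hj => ?_⟩
  have := gp_base S g⁻¹ (u i) (v j)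
  rw [inv_inv] at this
  rw [← this]; exact hN i hi j hj

lemma convInf_mul {S : Set Γ} (hS : IsGenSet S) {u : ℕ → Γ} (h : ConvInf S u) (g : Γ) :
    ConvInf S (fun n => g * u n) := equivSeq_mul hS h g

/-- `u` represents `η`. -/
def Rep {S : Set Γ} (B : Boundary Γ S) (u : ℕ → Γ) (η : B.pt) : Prop := ConvInf S u ∧ B.cls u = η

lemma exists_rep {S : Set Γ} (B : Boundary Γ S) (η : B.pt) : ∃ u, Rep B u η := B.cls_surj η

lemma rep_equiv {S : Set Γ} {B : Boundary Γ S} {u v : ℕ → Γ} {η : B.pt}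
    (hu : Rep B u η) (hv : Rep B v η) : EquivSeq S u v :=
  (B.cls_eq u v hu.1 hv.1).1 (hu.2.trans hv.2.symm)

lemma rep_mul {S : Set Γ} (hS : IsGenSet S) {B : Boundary Γ S} {u : ℕ → Γ} {η : B.pt}
    (hu : Rep B u η) (g : Γ) : Rep B (fun n => g * u n) (B.smul g η) :=
  ⟨convInf_mul hS hu.1 g, by rw [← hu.2, B.smul_cls g u hu.1]⟩

lemma smul_one {S : Set Γ} (B : Boundary Γ S) (η : B.pt) : B.smul 1 η = η := by
  obtain ⟨u, hu⟩ := exists_rep B η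
  rw [← hu.2, B.smul_cls 1 u hu.1]; simp

lemma smul_mul {S : Set Γ} (hS : IsGenSet S) (B : Boundary Γ S) (g h : Γ) (η : B.pt) :
    B.smul (g * h) η = B.smul g (B.smul h η) := by
  obtain ⟨u, hu⟩ := exists_rep B η
  have h1 := rep_mul hS hu h
  rw [← h1.2, B.smul_cls g _ h1.1, ← hu.2, B.smul_cls (g * h) u hu.1]
  simp [mul_assoc]

/-! ### Shadows -/

/-- shadow of `h` seen from `g`. -/
def Tset {S : Set Γ} (B : Boundary Γ S) (g h : Γ) (t : ℝ) : Set B.pt :=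
  {η | ∃ u, Rep B u η ∧ ∃ N, ∀ n ≥ N, t ≤ gp S g h (u n)}

lemma Tset_anti {S : Set Γ} (B : Boundary Γ S) (g h : Γ) {s t : ℝ} (hst : s ≤ t) :
    Tset B g h t ⊆ Tset B g h s := by
  rintro η ⟨u, hu, N, hN⟩
  exact ⟨u, hu, N, fun n hn => hst.trans (hN n hn)⟩

lemma Tset_all {S : Set Γ} {δ : ℝ} (hS : IsGenSet S) (hδ : IsHyperbolic S δ) {B : Boundary Γ S}
    {g h : Γ} {t : ℝ} {η : B.pt} (hη : η ∈ Tset B g h t) {v : ℕ → Γ} (hv : Rep B v η) :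
    ∃ N, ∀ n ≥ N, t - δ ≤ gp S g h (v n) := by
  obtain ⟨u, hu, N, hN⟩ := hη
  obtain ⟨M, hM⟩ := equivSeq_base hS (rep_equiv hu hv) g t
  refine ⟨M, fun n hn => ?_⟩
  exact hyp_ge hS hδ g h (u (max N M)) (v n) t (hN _ (le_max_left _ _))
    (hM _ (le_max_right _ _) n hn)

lemma notTset_all {S : Set Γ} {δ : ℝ} (hS : IsGenSet S) (hδ : IsHyperbolic S δ) {B : Boundary Γ S}
    {g h : Γ} {t : ℝ} {η : B.pt} (hη : η ∉ Tset B g h t) {v : ℕ → Γ} (hv : Rep B v η) :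
    ∃ N, ∀ n ≥ N, gp S g h (v n) < t + δ := by
  obtain ⟨M, hM⟩ := equivSeq_base hS hv.1 g (t + δ)
  refine ⟨M, fun n hn => ?_⟩
  by_contra hcon
  push Not at hcon
  apply hη
  refine ⟨v, hv, M, fun m hm => ?_⟩
  have := hyp_ge hS hδ g h (v n) (v m) _ hcon (hM n hn m hm)
  linarith

lemma smul_mem_Tset {S : Set Γ} (hS : IsGenSet S) {B : Boundary Γ S} (k g h : Γ) (t : ℝ) (η : B.pt)
    (hη : η ∈ Tset B g h t) : B.smul k η ∈ Tset B (k * g) (k * h) t := by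
  obtain ⟨u, hu, N, hN⟩ := hη
  exact ⟨_, rep_mul hS hu k, N, fun n hn => by rw [gp_left]; exact hN n hn⟩

lemma preimage_Tset {S : Set Γ} (hS : IsGenSet S) {B : Boundary Γ S} (g h : Γ) (t : ℝ) :
    B.smul g ⁻¹' (Tset B g h t) ⊆ Tset B 1 (g⁻¹ * h) t := by
  intro η hη
  have := smul_mem_Tset hS g⁻¹ g h t _ hη
  rw [← smul_mul hS] at this
  simpa [smul_one] using this

lemma exists_mem_Tset {S : Set Γ} (B : Boundary Γ S) (η : B.pt) (t : ℝ) :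
    ∃ h, η ∈ Tset B 1 h t := by
  obtain ⟨u, hu⟩ := exists_rep B η
  obtain ⟨N, hN⟩ := (convInf_iff u).1 hu.1 t
  exact ⟨u N, u, hu, N, fun n hn => hN N le_rfl n hn⟩

/-! ### The topology -/

lemma bgp_gt {S : Set Γ} {B : Boundary Γ S} {ξ η : B.pt}
    {r : ℝ} (hr0 : 0 ≤ r) (u v : ℕ → Γ) (hu : Rep B u ξ) (hv : Rep B v η)
    (h : ∃ N, ∀ i ≥ N, ∀ j ≥ N, r + 1 ≤ gp S 1 (u i) (v j)) : ENNReal.ofReal r < bgp B ξ η := by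
  obtain ⟨N, hN⟩ := h
  have h1 : ENNReal.ofReal (r + 1) ≤ bgp B ξ η := by
    unfold bgp
    refine le_trans ?_ (le_iSup_of_le ⟨u, hu⟩ (le_iSup_of_le ⟨v, hv⟩ le_rfl))
    apply le_liminf_of_le (by isBoundedDefault)
    rw [eventually_atTop]
    exact ⟨(N, N), fun p hp => ENNReal.ofReal_le_ofReal (hN p.1 hp.1 p.2 hp.2)⟩
  refine lt_of_lt_of_le ?_ h1
  have h0 : 0 < r + 1 := by linarith
  exact (ENNReal.ofReal_lt_ofReal_iff h0).2 (by linarith)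

lemma bgp_lt {S : Set Γ} {δ : ℝ} (hS : IsGenSet S) (hδ : IsHyperbolic S δ) {B : Boundary Γ S}
    {ξ η : B.pt} {r : ℝ} (hr : ENNReal.ofReal r < bgp B ξ η) (u v : ℕ → Γ)
    (hu : Rep B u ξ) (hv : Rep B v η) :
    ∃ N, ∀ i ≥ N, ∀ j ≥ N, r - 2 * δ ≤ gp S 1 (u i) (v j) := by
  unfold bgp at hr
  obtain ⟨⟨u', hu'⟩, hr⟩ := lt_iSup_iff.1 hr
  obtain ⟨⟨v', hv'⟩, hr⟩ := lt_iSup_iff.1 hr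
  have hev := eventually_lt_of_lt_liminf hr (by isBoundedDefault)
  rw [eventually_atTop] at hev
  obtain ⟨⟨a, b⟩, hab⟩ := hev
  obtain ⟨N1, h1⟩ := (equivSeq_iff _ _).1 (rep_equiv hu hu') r
  obtain ⟨N2, h2⟩ := (equivSeq_iff _ _).1 (rep_equiv hv' hv) r
  refine ⟨max N1 N2, fun i hi j hj => ?_⟩
  set A := max N1 a
  set C := max N2 b
  have e1 := h1 i (le_trans (le_max_left _ _) hi) A (le_max_left _ _)
  have e2 := h2 C (le_max_left _ _) j (le_trans (le_max_right _ _) hj)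
  have e3 := hab (A, C) ⟨le_max_right _ _, le_max_right _ _⟩
  have e3' : r < gp S 1 (u' A) (v' C) := by
    by_contra hcon
    exact absurd e3 (not_lt.2 (ENNReal.ofReal_le_ofReal (not_lt.1 hcon)))
  have e4 := hyp_ge hS hδ 1 (u i) (u' A) (v' C) r e1 e3'.le
  have := hyp_ge hS hδ 1 (u i) (v' C) (v j) (r - δ) e4 (by linarith [hδ.1])
  linarith

/-- open shadows -/
def Wset {S : Set Γ} (B : Boundary Γ S) (h : Γ) (s : ℝ) : Set B.pt :=
  {η | ∃ r : ℝ, 0 ≤ r ∧ {q | ENNReal.ofReal r < bgp B q η} ⊆ Tset B 1 h s}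

lemma Wset_open {S : Set Γ} {δ : ℝ} (hS : IsGenSet S) (hδ : IsHyperbolic S δ) (B : Boundary Γ S)
    (h : Γ) (s : ℝ) : @IsOpen B.pt (btop B) (Wset B h s) := by
  rintro p ⟨r, hr, hp⟩
  refine ⟨ENNReal.ofReal (r + 3 * δ + 1), ENNReal.ofReal_ne_top, fun q hq => ?_⟩
  have h0 := hδ.1
  refine ⟨r + 3 * δ + 1, by linarith, fun z hz => hp ?_⟩
  obtain ⟨u, hu⟩ := exists_rep B p
  obtain ⟨v, hv⟩ := exists_rep B q
  obtain ⟨w, hw⟩ := exists_rep B z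
  refine bgp_gt hr w u hw hu ?_
  obtain ⟨N, hN⟩ := bgp_lt hS hδ hq v u hv hu
  obtain ⟨M, hM⟩ := bgp_lt hS hδ hz w v hw hv
  refine ⟨max N M, fun i hi j hj => ?_⟩
  have e1 := hN (max N M) (le_max_left _ _) j (le_trans (le_max_left _ _) hj)
  have e2 := hM i (le_trans (le_max_right _ _) hi) (max N M) (le_max_right _ _)
  have := hyp_ge hS hδ 1 _ _ _ _ e2 e1
  linarith

lemma Wset_sub {S : Set Γ} (B : Boundary Γ S)
    (h : Γ) (s : ℝ) : Wset B h s ⊆ Tset B 1 h s := by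
  rintro p ⟨r, hr, hp⟩
  obtain ⟨u, hu⟩ := exists_rep B p
  exact hp (bgp_gt hr u u hu hu ((convInf_iff u).1 hu.1 _))

lemma Wset_sup {S : Set Γ} {δ : ℝ} (hS : IsGenSet S) (hδ : IsHyperbolic S δ) (B : Boundary Γ S)
    (h : Γ) (s : ℝ) : Tset B 1 h (s + 2 * δ) ⊆ Wset B h s := by
  intro η hη
  have h0 := hδ.1
  refine ⟨|s| + 4 * δ, by positivity, fun q hq => ?_⟩
  obtain ⟨u, hu⟩ := exists_rep B η
  obtain ⟨v, hv⟩ := exists_rep B q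
  obtain ⟨N, hN⟩ := bgp_lt hS hδ hq v u hv hu
  obtain ⟨M, hM⟩ := Tset_all hS hδ hη hu
  refine ⟨v, hv, N, fun n hn => ?_⟩
  have e1 := hN n hn (max N M) (le_max_left _ _)
  have e2 := hM (max N M) (le_max_right _ _)
  rw [gp_comm hS] at e1
  have := hyp_ge hS hδ 1 h _ _ (s + δ) (by linarith) (le_trans (by linarith [le_abs_self s]) e1)
  linarith

lemma smul_continuous {S : Set Γ} {δ : ℝ} (hS : IsGenSet S) (hδ : IsHyperbolic S δ)
    (B : Boundary Γ S) (g : Γ) (O : Set B.pt) (hO : @IsOpen B.pt (btop B) O) :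
    @IsOpen B.pt (btop B) (B.smul g ⁻¹' O) := by
  intro p hp
  have h0 := hδ.1
  obtain ⟨r, hr, hsub⟩ := hO _ hp
  refine ⟨ENNReal.ofReal (r.toReal + 2 * δ + wdist S 1 g⁻¹ + 1), ENNReal.ofReal_ne_top,
    fun q hq => hsub ?_⟩
  obtain ⟨u, hu⟩ := exists_rep B p
  obtain ⟨v, hv⟩ := exists_rep B q
  obtain ⟨N, hN⟩ := bgp_lt hS hδ hq v u hv hu
  show r < _
  rw [← ENNReal.ofReal_toReal hr]
  refine bgp_gt ENNReal.toReal_nonneg _ _ (rep_mul hS hv g) (rep_mul hS hu g) ⟨N, fun i hi j hj => ?_⟩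
  have h1 := gp_base S g⁻¹ (v i) (u j)
  rw [inv_inv] at h1
  rw [← h1]
  have h2 := gp_lip_base hS 1 g⁻¹ (v i) (u j)
  linarith [hN i hi j hj]

/-! ### Geodesic rays -/

lemma ray_gp {S : Set Γ} {x : ℕ → Γ} (hx : IsGeodesicRay S x) {m n : ℕ} (h : m ≤ n) :
    gp S 1 (x m) (x n) = m := by
  have h1 := hx.2 m 0
  have h2 := hx.2 n 0
  have h3 := hx.2 m n
  rw [hx.1] at h1 h2
  unfold gp
  rw [h1, h2, h3, Nat.dist_eq_sub_of_le h]
  simp only [Nat.dist_zero_right]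
  rw [Nat.cast_sub h]; ring

lemma ray_convInf {S : Set Γ} (hS : IsGenSet S) {x : ℕ → Γ} (hx : IsGeodesicRay S x) : ConvInf S x := by
  rw [convInf_iff]
  intro C
  obtain ⟨N, hN⟩ := exists_nat_ge C
  refine ⟨N, fun i hi j hj => ?_⟩
  have hi' : (N : ℝ) ≤ i := by exact_mod_cast hi
  have hj' : (N : ℝ) ≤ j := by exact_mod_cast hj
  rcases le_total i j with h | h
  · rw [ray_gp hx h]; linarith
  · rw [gp_comm hS, ray_gp hx h]; linarith

/-- Limit of geodesic segments along an ultrafilter. -/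
lemma exists_limit_ray {S : Set Γ} (hS : IsGenSet S) (h : ℕ → Γ)
    (hinf : ∀ C : ℕ, ∀ᶠ n in (hyperfilter ℕ : Filter ℕ), C ≤ wl S (h n)) :
    ∃ x : ℕ → Γ, IsGeodesicRay S x ∧
      ∀ m : ℕ, ∀ᶠ n in (hyperfilter ℕ : Filter ℕ), gp S 1 (x m) (h n) = m := by
  choose α h0 hend hgeo using fun n => exists_geod hS (h n)
  have key : ∀ m, ∃ a, ∀ᶠ n in (hyperfilter ℕ : Filter ℕ), α n m = a := by
    intro m
    have hfin := wball_finite hS m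
    have : ∀ᶠ n in (hyperfilter ℕ : Filter ℕ), ∃ a ∈ {g : Γ | wl S g ≤ m}, α n m = a := by
      filter_upwards [hinf m] with n hn
      refine ⟨_, ?_, rfl⟩
      have := hgeo n 0 m (Nat.zero_le _) hn
      rw [h0, wdist_one] at this
      show wl S (α n m) ≤ m
      rw [this, Nat.dist_zero_left]
    have h2 := (Ultrafilter.eventually_exists_mem_iff hfin).1 this
    obtain ⟨a, -, ha⟩ := h2
    exact ⟨a, ha⟩
  choose x hx using key
  refine ⟨x, ⟨?_, ?_⟩, ?_⟩
  · obtain ⟨n, hn⟩ := (hx 0).exists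
    rw [← hn, h0]
  · intro m k
    obtain ⟨n, h1, h2, h3, h4⟩ := ((hx m).and ((hx k).and ((hinf m).and (hinf k)))).exists
    rw [← h1, ← h2]
    exact hgeo n m k h3 h4
  · intro m
    filter_upwards [hx m, hinf m] with n h1 h3
    have e1 := hgeo n m 0 h3 (Nat.zero_le _)
    have e2 := hgeo n m (wl S (h n)) h3 le_rfl
    rw [hend n _ le_rfl, h1] at e2
    rw [h0, h1] at e1
    unfold gp
    rw [e1, e2, wdist_comm hS (h n) 1, wdist_one, Nat.dist_eq_sub_of_le h3, Nat.cast_sub h3]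
    simp only [Nat.dist_zero_right]
    ring

lemma exists_ray {S : Set Γ} {δ : ℝ} (hS : IsGenSet S) (hδ : IsHyperbolic S δ) (B : Boundary Γ S)
    (η : B.pt) : ∃ x, RayTo B x η := by
  obtain ⟨u, hu⟩ := exists_rep B η
  have hconv := (convInf_iff u).1 hu.1
  obtain ⟨x, hx, hxu⟩ := exists_limit_ray hS u (by
    intro C
    obtain ⟨N, hN⟩ := hconv C
    have : ∀ᶠ n in atTop, C ≤ wl S (u n) := by
      filter_upwards [eventually_ge_atTop N] with n hn
      have h1 := (hN n hn n hn).trans (gp_le_left hS 1 (u n) (u n))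
      rw [wdist_comm hS, wdist_one] at h1
      exact_mod_cast h1
    exact Nat.hyperfilter_le_atTop this)
  have hc := ray_convInf hS hx
  refine ⟨x, hx, hc, ?_⟩
  rw [← hu.2, B.cls_eq x u hc hu.1, equivSeq_iff]
  intro C
  obtain ⟨N, hN⟩ := hconv (C + δ)
  obtain ⟨M, hM⟩ := exists_nat_ge (C + δ)
  refine ⟨max N M, fun i hi j hj => ?_⟩
  have hev : ∀ᶠ n in (hyperfilter ℕ : Filter ℕ), N ≤ n :=
    Nat.hyperfilter_le_atTop (eventually_ge_atTop N)
  obtain ⟨n, h1, h2⟩ := ((hxu i).and hev).exists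
  have h3 : (M : ℝ) ≤ i := by exact_mod_cast (le_trans (le_max_right _ _) hi)
  have := hyp_ge hS hδ 1 (x i) (u n) (u j) (C + δ) (by linarith)
    (hN n h2 j (le_trans (le_max_left _ _) hj))
  linarith

end

section

/-! ### No finite orbits on the boundary -/

/-- `g` shifts the ray `x` by `n` up to an error `c`. -/
def Shift (S : Set Γ) (x : ℕ → Γ) (g : Γ) (n : ℤ) (c : ℕ) : Prop :=
  ∃ M : ℕ, ∀ m ≥ M, wdist S (g * x m) (x ((m : ℤ) + n).toNat) ≤ c

lemma Shift.mul {S : Set Γ} (hS : IsGenSet S) {x : ℕ → Γ} {g g' : Γ} {n n' : ℤ} {c c' : ℕ}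
    (h : Shift S x g n c) (h' : Shift S x g' n' c') : Shift S x (g * g') (n + n') (c + c') := by
  obtain ⟨M, hM⟩ := h
  obtain ⟨M', hM'⟩ := h'
  refine ⟨M' + M + n'.natAbs, fun m hm => ?_⟩
  have e1 := hM' m (by omega)
  have e2 := hM ((m : ℤ) + n').toNat (by omega)
  have e3 : (((((m : ℤ) + n').toNat : ℕ) : ℤ) + n).toNat = ((m : ℤ) + (n + n')).toNat := by omega
  rw [e3] at e2
  rw [← wdist_left S g, ← mul_assoc] at e1
  have := wdist_tri hS (g * g' * x m) (g * x ((m : ℤ) + n').toNat) (x ((m : ℤ) + (n + n')).toNat)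
  omega

lemma Shift.inv {S : Set Γ} (hS : IsGenSet S) {x : ℕ → Γ} {g : Γ} {n : ℤ} {c : ℕ}
    (h : Shift S x g n c) : Shift S x g⁻¹ (-n) c := by
  obtain ⟨M, hM⟩ := h
  refine ⟨M + n.natAbs, fun m hm => ?_⟩
  have e2 := hM ((m : ℤ) + -n).toNat (by omega)
  have e3 : (((((m : ℤ) + -n).toNat : ℕ) : ℤ) + n).toNat = m := by omega
  rw [e3] at e2
  rw [← wdist_left S g, wdist_comm hS]
  simpa using e2

lemma Shift.shift {S : Set Γ} (hS : IsGenSet S) {x : ℕ → Γ} (hx : IsGeodesicRay S x) {g : Γ}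
    {n n' : ℤ} {c : ℕ} (h : Shift S x g n c) : Shift S x g n' (c + (n - n').natAbs) := by
  obtain ⟨M, hM⟩ := h
  refine ⟨M + n.natAbs + n'.natAbs, fun m hm => ?_⟩
  have e2 := hM m (by omega)
  have := wdist_tri hS (g * x m) (x ((m : ℤ) + n).toNat) (x ((m : ℤ) + n').toNat)
  rw [hx.2] at this
  have : Nat.dist ((m : ℤ) + n).toNat ((m : ℤ) + n').toNat ≤ (n - n').natAbs := by
    unfold Nat.dist; omega
  omega

lemma Shift.mono {S : Set Γ} {x : ℕ → Γ} {g : Γ} {n : ℤ} {c c' : ℕ} (hc : c ≤ c')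
    (h : Shift S x g n c) : Shift S x g n c' := by
  obtain ⟨M, hM⟩ := h
  exact ⟨M, fun m hm => (hM m hm).trans hc⟩

/-- If `k` has two shifts, they are close. -/
lemma Shift.uniq {S : Set Γ} (hS : IsGenSet S) {x : ℕ → Γ} (hx : IsGeodesicRay S x) {g : Γ}
    {n n' : ℤ} {c c' : ℕ} (h : Shift S x g n c) (h' : Shift S x g n' c') :
    (n - n').natAbs ≤ c + c' := by
  obtain ⟨M, hM⟩ := h
  obtain ⟨M', hM'⟩ := h'
  set m := M + M' + n.natAbs + n'.natAbs with hm
  have e1 := hM m (by omega)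
  have e2 := hM' m (by omega)
  have := wdist_tri hS (x ((m : ℤ) + n).toNat) (g * x m) (x ((m : ℤ) + n').toNat)
  rw [hx.2, wdist_comm hS _ (g * x m)] at this
  unfold Nat.dist at this; omega

lemma shift_finite {S : Set Γ} (hS : IsGenSet S) (x : ℕ → Γ) (c : ℕ) :
    {k | Shift S x k 0 c}.Finite := by
  by_contra hinf
  have hfin := wball_finite hS c
  obtain ⟨t, ht, hcard⟩ := Set.Infinite.exists_subset_card_eq hinf (hfin.toFinset.card + 1)
  have hM : ∀ k ∈ t, ∃ M : ℕ, ∀ m ≥ M, wdist S (k * x m) (x m) ≤ c := by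
    intro k hk
    obtain ⟨M, hM⟩ := ht hk
    exact ⟨M, fun m hm => by simpa using hM m hm⟩
  choose! M hM using hM
  set m := t.sup M
  have h1 : t.card ≤ hfin.toFinset.card := by
    apply Finset.card_le_card_of_injOn (fun k => (k * x m)⁻¹ * x m)
    · intro k hk
      have := hM k hk m (Finset.le_sup hk)
      simpa [wdist] using this
    · intro a _ b _ hab
      simpa using hab
  omega

lemma exists_shift {S : Set Γ} {δ : ℝ} (hS : IsGenSet S) (hδ : IsHyperbolic S δ) {B : Boundary Γ S}
    {ξ : B.pt} {x : ℕ → Γ} (hx : RayTo B x ξ) {g : Γ} (hg : B.smul g ξ = ξ) :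
    ∃ n, Shift S x g n ⌈4 * δ⌉₊ := by
  have hr : Rep B x ξ := hx.2
  have hr' := rep_mul hS hr g
  rw [hg] at hr'
  have heq := rep_equiv hr' hr
  set f : ℕ → ℕ := fun m => wdist S 1 (g * x m) with hf
  have hstep : ∀ m m', m ≤ m' → f m' ≤ f m + (m' - m) := by
    intro m m' h
    have := wdist_tri hS 1 (g * x m) (g * x m')
    rw [wdist_left, hx.1.2, Nat.dist_eq_sub_of_le h] at this
    exact this
  have hlow : ∀ m, m ≤ f m + wdist S 1 g := by
    intro m
    have h1 := wdist_tri hS g 1 (g * x m)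
    have h2 := wdist_left S g (x 0) (x m)
    rw [hx.1.2, Nat.dist_zero_left, hx.1.1, mul_one] at h2
    rw [wdist_comm hS g 1] at h1
    show m ≤ wdist S 1 (g * x m) + wdist S 1 g
    omega
  obtain ⟨m0, hm0⟩ : ∃ m0, ∀ m ≥ m0, f m + m0 = f m0 + m := by
    have hmem := Nat.sInf_mem (s := Set.range fun m => f m + wdist S 1 g - m) ⟨_, 0, rfl⟩
    obtain ⟨m0, h0⟩ := hmem
    refine ⟨m0, fun m hm => ?_⟩
    have h1 : sInf (Set.range fun m => f m + wdist S 1 g - m) ≤ f m + wdist S 1 g - m :=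
      Nat.sInf_le ⟨m, rfl⟩
    simp only at h0
    have h2 := hstep m0 m hm
    have h3 := hlow m
    have h4 := hlow m0
    omega
  refine ⟨(f m0 : ℤ) - m0, m0, fun m hm => ?_⟩
  have hj : ((m : ℤ) + ((f m0 : ℤ) - m0)).toNat = f m := by
    have := hm0 m hm; omega
  rw [hj]
  obtain ⟨N, hN⟩ := (equivSeq_iff _ _).1 heq (f m)
  set L := max (max N m) (f m)
  have e1 : gp S 1 (g * x m) (g * x L) = f m := by
    have hL : m ≤ L := (le_max_right N m).trans (le_max_left _ _)
    have a1 := hm0 m hm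
    have a2 := hm0 L (hm.le.trans hL)
    unfold gp
    rw [wdist_left, hx.1.2, Nat.dist_eq_sub_of_le hL, Nat.cast_sub hL,
      wdist_comm hS _ 1, wdist_comm hS _ 1]
    have a3 : (f m : ℝ) + m0 = f m0 + m := by exact_mod_cast a1
    have a4 : (f L : ℝ) + m0 = f m0 + L := by exact_mod_cast a2
    simp only [hf] at *
    linarith
  have e2 := hN L ((le_max_left N m).trans (le_max_left _ _)) L ((le_max_left N m).trans (le_max_left _ _))
  have e3 := ray_gp hx.1 (le_max_right (max N m) (f m))
  rw [gp_comm hS] at e3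
  have e4 := hyp_ge hS hδ 1 _ _ _ _ e1.ge e2
  have e5 := hyp_ge hS hδ 1 _ _ _ _ e4 (by rw [e3]; linarith [hδ.1])
  have e6 : (wdist S (g * x m) (x (f m)) : ℝ) ≤ 4 * δ := by
    unfold gp at e5
    have b1 := hx.1.2 (f m) 0
    rw [hx.1.1, Nat.dist_zero_right] at b1
    rw [b1, wdist_comm hS _ 1] at e5
    simp only [hf] at *
    linarith
  exact_mod_cast e6.trans (Nat.le_ceil _)

lemma no_finite_orbit {S : Set Γ} {δ : ℝ} (hS : IsGenSet S) (hδ : IsHyperbolic S δ)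
    (hne : Nonelementary Γ) (B : Boundary Γ S) (ξ : B.pt) (F : Set Γ) (hF : F.Finite)
    (hcov : ∀ g, ∃ t ∈ F, B.smul g ξ = B.smul t ξ) : False := by
  obtain ⟨x, hx⟩ := exists_ray hS hδ B ξ
  set C := ⌈4 * δ⌉₊
  have hcov' : ∀ g, ∃ t ∈ F, ∃ γ, B.smul γ ξ = ξ ∧ g = γ * t⁻¹ := by
    intro g
    obtain ⟨t, ht, h⟩ := hcov g⁻¹
    refine ⟨t, ht, g * t, ?_, by group⟩
    rw [smul_mul hS, ← h, ← smul_mul hS, mul_inv_cancel, smul_one]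
  -- it suffices to cover the stabilizer
  have suff : ∀ γ : Γ, ∀ K : Set Γ, K.Finite →
      (∀ g, B.smul g ξ = ξ → ∃ k ∈ K, ∃ j : ℤ, g = γ ^ j * k) → False := by
    intro γ K hK h
    apply absurd (hne γ)
    have hfin : ((fun a : Γ => (QuotientGroup.mk a : Γ ⧸ Subgroup.zpowers γ)) ''
        (Set.image2 (fun t k => t * k⁻¹) F K)).Finite := (hF.image2 _ hK).image _
    have hu : Finite (Γ ⧸ Subgroup.zpowers γ) := by
      rw [← Set.finite_univ_iff]
      apply hfin.subset
      rintro q -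
      obtain ⟨a, rfl⟩ := QuotientGroup.mk_surjective q
      obtain ⟨t, ht, g, hg, e⟩ := hcov' a⁻¹
      obtain ⟨k, hk, j, e2⟩ := h g hg
      refine ⟨t * k⁻¹, ⟨t, ht, k, hk, rfl⟩, ?_⟩
      have ea : a = t * k⁻¹ * γ ^ (-j) := by
        rw [← inv_inv a, e, e2]; group
      rw [ea, QuotientGroup.mk_mul_of_mem]
      exact ⟨-j, rfl⟩
    exact Subgroup.index_ne_zero_of_finite
  -- a stabilizer element with large shift
  obtain ⟨γ, n₁, hγ, hγs, hn₁⟩ : ∃ γ, ∃ n : ℤ, B.smul γ ξ = ξ ∧ Shift S x γ n C ∧ 3 * C + 1 ≤ n := by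
    by_contra hcon
    push Not at hcon
    apply suff 1 _ (shift_finite hS x (C + (3 * C + 1)))
    intro g hg
    refine ⟨g, ?_, 0, by simp⟩
    obtain ⟨n, hn⟩ := exists_shift hS hδ hx hg
    have h1 := hcon g n hg hn
    have hg' : B.smul g⁻¹ ξ = ξ := by
      conv_lhs => rw [← hg]
      rw [← smul_mul hS, inv_mul_cancel, smul_one]
    have h2 := hcon g⁻¹ (-n) hg' (hn.inv hS)
    exact (hn.shift hS hx.1 (n' := 0)).mono (by omega)
  have hpow : ∀ j : ℕ, B.smul (γ ^ j) ξ = ξ := by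
    intro j
    induction j with
    | zero => simp [smul_one]
    | succ j ih => rw [pow_succ, smul_mul hS, hγ, ih]
  choose n hn using fun j => exists_shift hS hδ hx (hpow j)
  have hstep : ∀ j, n j + 1 ≤ n (j + 1) ∧ n (j + 1) ≤ n j + n₁ + 3 * C := by
    intro j
    have h1 := (hn j).mul hS hγs
    rw [← pow_succ] at h1
    have := Shift.uniq hS hx.1 h1 (hn (j + 1))
    omega
  have hn0 : (n 0).natAbs ≤ C := by
    have h1 : Shift S x (γ ^ 0) 0 0 := ⟨0, fun m _ => by simp [wdist_self]⟩
    have := Shift.uniq hS hx.1 (hn 0) h1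
    simpa using this
  obtain ⟨L, hL⟩ : ∃ L : ℕ, (L : ℤ) = n₁ + 3 * C + C := ⟨(n₁ + 3 * C + C).toNat, by omega⟩
  have hfind : ∀ a : ℤ, 0 ≤ a → ∃ j : ℕ, (n j - a).natAbs ≤ L := by
    intro a ha
    have hgrow : ∀ j : ℕ, n 0 + j ≤ n j := by
      intro j
      induction j with
      | zero => simp
      | succ j ih => have := (hstep j).1; push_cast; omega
    have hex : ∃ j, a ≤ n j := ⟨(a + C).toNat, by have := hgrow (a + C).toNat; omega⟩
    classical
    have hj := Nat.find_spec hex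
    rcases Nat.eq_zero_or_pos (Nat.find hex) with h0 | h0
    · refine ⟨0, ?_⟩
      rw [h0] at hj; omega
    · obtain ⟨i, hi⟩ := Nat.exists_eq_succ_of_ne_zero h0.ne'
      have h2 := Nat.find_min hex (m := i) (by omega)
      rw [hi] at hj
      refine ⟨i + 1, ?_⟩
      have := hstep i
      simp only [Nat.succ_eq_add_one] at hj
      omega
  apply suff γ _ (shift_finite hS x (C + C + L))
  intro g hg
  obtain ⟨a, ha⟩ := exists_shift hS hδ hx hg
  rcases le_total 0 a with h0 | h0
  · obtain ⟨j, hj⟩ := hfind a h0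
    refine ⟨(γ ^ j)⁻¹ * g, ?_, j, by simp⟩
    have h1 := ((hn j).inv hS).mul hS ha
    exact (h1.shift hS hx.1 (n' := 0)).mono (by omega)
  · obtain ⟨j, hj⟩ := hfind (-a) (by omega)
    refine ⟨γ ^ j * g, ?_, -j, by simp⟩
    have h1 := (hn j).mul hS ha
    exact (h1.shift hS hx.1 (n' := 0)).mono (by omega)

end

section

/-! ### The Markov operator -/

/-- The Markov operator, `T` is a finite set containing the support of `μ`. -/
def Pop (T : Finset Γ) (μ : Γ → ℝ) : Module.End ℝ (Γ → ℝ) where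
  toFun f g := ∑ s ∈ T, μ s * f (g * s)
  map_add' f h := by
    funext g; simp [mul_add, Finset.sum_add_distrib]
  map_smul' c f := by
    funext g
    simp only [Pi.smul_apply, smul_eq_mul, RingHom.id_apply, Finset.mul_sum]
    exact Finset.sum_congr rfl fun s _ => by ring

/-- `T` carries the finitely supported probability `μ`, with support in `S`. -/
structure Carrier (S : Set Γ) (T : Finset Γ) (μ : Γ → ℝ) : Prop where
  nonneg : ∀ g, 0 ≤ μ g
  sub : ∀ s ∈ T, s ∈ S
  supp : ∀ s, μ s ≠ 0 → s ∈ T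
  total : ∑ s ∈ T, μ s = 1

lemma exists_carrier {S : Set Γ} (hS : IsGenSet S) {μ : Γ → ℝ} (hμ : IsRWMeasure S μ) :
    Carrier S hS.1.toFinset μ where
  nonneg := hμ.nonneg
  sub s hs := by simpa using hs
  supp s hs := by simpa using hμ.support_subset s hs
  total := by
    rw [← hμ.total]
    symm
    apply tsum_eq_sum
    intro b hb
    by_contra h
    exact hb (by simpa using hμ.support_subset b h)

section
variable {S : Set Γ} {T : Finset Γ} {μ : Γ → ℝ}

lemma Pop_apply (f : Γ → ℝ) (g : Γ) : Pop T μ f g = ∑ s ∈ T, μ s * f (g * s) := rfl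

lemma Pop_pow_succ (n : ℕ) (f : Γ → ℝ) : (Pop T μ ^ (n + 1)) f = (Pop T μ ^ n) (Pop T μ f) := by
  rw [pow_succ]; rfl

lemma Pop_pow_succ' (n : ℕ) (f : Γ → ℝ) : (Pop T μ ^ (n + 1)) f = Pop T μ ((Pop T μ ^ n) f) := by
  rw [pow_succ']; rfl

lemma Pop_pow_add (n m : ℕ) (f : Γ → ℝ) :
    (Pop T μ ^ (n + m)) f = (Pop T μ ^ n) ((Pop T μ ^ m) f) := by
  rw [pow_add]; rfl

lemma Pop_local (hT : Carrier S T μ) (hS : IsGenSet S) (n : ℕ) (x : Γ) (f h : Γ → ℝ)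
    (hfh : ∀ y, wdist S x y ≤ n → f y ≤ h y) : (Pop T μ ^ n) f x ≤ (Pop T μ ^ n) h x := by
  induction n generalizing x with
  | zero => simpa using hfh x (by simp [wdist_self])
  | succ n ih =>
    rw [Pop_pow_succ', Pop_pow_succ', Pop_apply, Pop_apply]
    apply Finset.sum_le_sum
    intro s hs
    apply mul_le_mul_of_nonneg_left _ (hT.nonneg s)
    apply ih
    intro y hy
    apply hfh
    have h1 := wdist_tri hS x (x * s) y
    have h2 := wdist_mul_gen (hT.sub s hs) x
    omega

lemma Pop_mono (hT : Carrier S T μ) (n : ℕ) {f h : Γ → ℝ}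
    (hfh : ∀ y, f y ≤ h y) (x : Γ) : (Pop T μ ^ n) f x ≤ (Pop T μ ^ n) h x := by
  induction n generalizing x with
  | zero => simpa using hfh x
  | succ n ih =>
    rw [Pop_pow_succ', Pop_pow_succ', Pop_apply, Pop_apply]
    apply Finset.sum_le_sum
    intro s hs
    exact mul_le_mul_of_nonneg_left (ih _) (hT.nonneg s)

lemma Pop_const (hT : Carrier S T μ) (n : ℕ) (c : ℝ) (x : Γ) : (Pop T μ ^ n) (fun _ => c) x = c := by
  induction n generalizing x with
  | zero => simp
  | succ n ih =>
    rw [Pop_pow_succ', Pop_apply]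
    simp only [ih]
    rw [← Finset.sum_mul, hT.total, one_mul]

lemma Pop_nonneg (hT : Carrier S T μ) (n : ℕ) {f : Γ → ℝ} (hf : ∀ y, 0 ≤ f y) (x : Γ) :
    0 ≤ (Pop T μ ^ n) f x := by
  have := Pop_mono hT n (f := fun _ => 0) hf x
  rwa [Pop_const hT] at this

lemma Pop_trans (n : ℕ) (f : Γ → ℝ) (k x : Γ) :
    (Pop T μ ^ n) (fun y => f (k * y)) x = (Pop T μ ^ n) f (k * x) := by
  induction n generalizing x with
  | zero => simp
  | succ n ih =>
    rw [Pop_pow_succ', Pop_pow_succ', Pop_apply, Pop_apply]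
    simp only [ih, mul_assoc]

lemma Pop_fix {f : Γ → ℝ} (hf : Pop T μ f = f) (n : ℕ) : (Pop T μ ^ n) f = f := by
  induction n with
  | zero => simp
  | succ n ih => rw [Pop_pow_succ', ih, hf]

/-- Dirac function -/
noncomputable def dl (y : Γ) : Γ → ℝ := Set.indicator {y} (fun _ => 1)

lemma dl_self (y : Γ) : dl y y = 1 := by simp [dl]
lemma dl_ne {x y : Γ} (h : x ≠ y) : dl y x = 0 := by simp [dl, h]
lemma dl_nonneg (y x : Γ) : 0 ≤ dl y x := by
  unfold dl; exact Set.indicator_nonneg (fun _ _ => zero_le_one) _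

/-- n-step transition probability. -/
noncomputable def pn (T : Finset Γ) (μ : Γ → ℝ) (n : ℕ) (x y : Γ) : ℝ := (Pop T μ ^ n) (dl y) x

lemma pn_nonneg (hT : Carrier S T μ) (n : ℕ) (x y : Γ) : 0 ≤ pn T μ n x y :=
  Pop_nonneg hT n (dl_nonneg y) x

lemma pn_trans (k : Γ) (n : ℕ) (x y : Γ) : pn T μ n (k * x) (k * y) = pn T μ n x y := by
  unfold pn
  rw [← Pop_trans]
  have : (fun z => dl (k * y) (k * z)) = dl y := by
    funext z
    by_cases h : z = y
    · subst h; simp [dl_self]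
    · rw [dl_ne h, dl_ne]; simpa using h
  rw [this]

lemma le_of_dl (hT : Carrier S T μ) (n : ℕ) (x y : Γ) {f : Γ → ℝ} (hf : ∀ z, 0 ≤ f z) :
    pn T μ n x y * f y ≤ (Pop T μ ^ n) f x := by
  have h1 := Pop_mono hT n (f := f y • dl y) (h := f) (by
    intro z
    by_cases h : z = y
    · subst h; simp [dl_self]
    · simp [dl_ne h, hf]) x
  rw [map_smul] at h1
  simp only [Pi.smul_apply, smul_eq_mul] at h1
  unfold pn; linarith

lemma pn_add (hT : Carrier S T μ) (n m : ℕ) (x y z : Γ) :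
    pn T μ n x y * pn T μ m y z ≤ pn T μ (n + m) x z := by
  have := le_of_dl hT n x y (f := (Pop T μ ^ m) (dl z)) (fun w => pn_nonneg hT m w z)
  rw [← Pop_pow_add] at this
  exact this

lemma pn_list (hT : Carrier S T μ) (l : List Γ) (hl : ∀ x ∈ l, 0 < μ x) :
    ∃ c : ℝ, 0 < c ∧ ∀ x, c ≤ pn T μ l.length x (x * l.prod) := by
  induction l with
  | nil => exact ⟨1, one_pos, fun x => by simp [pn, dl_self]⟩
  | cons a l ih =>
    obtain ⟨c, hc, h⟩ := ih (fun x hx => hl x (by simp [hx]))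
    have ha : 0 < μ a := hl a (by simp)
    refine ⟨μ a * c, by positivity, fun x => ?_⟩
    have h1 : μ a ≤ pn T μ 1 x (x * a) := by
      unfold pn
      rw [pow_one, Pop_apply]
      have := Finset.single_le_sum (f := fun s => μ s * dl (x * a) (x * s)) (s := T)
        (fun i _ => mul_nonneg (hT.nonneg i) (dl_nonneg _ _)) (hT.supp a ha.ne')
      simpa [dl_self] using this
    have h2 := pn_add hT 1 l.length x (x * a) (x * (a :: l).prod)
    have h3 := h (x * a)
    rw [List.length_cons, add_comm]
    rw [mul_assoc, ← List.prod_cons] at h3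
    refine le_trans ?_ h2
    exact mul_le_mul h1 h3 hc.le (pn_nonneg hT _ _ _)

lemma exists_small (T : Finset Γ) (c : Γ → ℝ) (hc : ∀ s ∈ T, 0 < c s) :
    ∃ ε : ℝ, 0 < ε ∧ ε ≤ 1 ∧ ∀ s ∈ T, ε ≤ c s := by
  classical
  induction T using Finset.induction_on with
  | empty => exact ⟨1, by simp⟩
  | insert a T _ ih =>
    obtain ⟨ε, h1, h2, h3⟩ := ih (fun s hs => hc s (by simp [hs]))
    refine ⟨min ε (c a), lt_min h1 (hc a (by simp)), (min_le_left _ _).trans h2, ?_⟩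
    intro s hs
    rcases Finset.mem_insert.1 hs with rfl | hs
    · exact min_le_right _ _
    · exact (min_le_left _ _).trans (h3 s hs)

lemma pn_lower (hS : IsGenSet S) (hμ : IsRWMeasure S μ) (hT : Carrier S T μ) :
    ∃ ε : ℝ, 0 < ε ∧ ε ≤ 1 ∧ ∀ x y, ∃ m, ε ^ (wdist S x y) ≤ pn T μ m x y := by
  have h1 : ∀ s : Γ, ∃ c : ℝ, 0 < c ∧ ∃ m, ∀ x, c ≤ pn T μ m x (x * s) := by
    intro s
    obtain ⟨l, -, hl, rfl⟩ := hμ.nondeg s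
    obtain ⟨c, hc, h⟩ := pn_list hT l hl
    exact ⟨c, hc, l.length, h⟩
  choose c hc m hm using h1
  obtain ⟨ε, h0, h1, hε⟩ := exists_small hS.1.toFinset c (fun s _ => hc s)
  refine ⟨ε, h0, h1, ?_⟩
  have key : ∀ w : List Γ, (∀ s ∈ w, s ∈ S) → ∀ x, ∃ m, ε ^ w.length ≤ pn T μ m x (x * w.prod) := by
    intro w
    induction w with
    | nil => intro _ x; exact ⟨0, by simp [pn, dl_self]⟩
    | cons a l ih =>
      intro hw x
      obtain ⟨k, hk⟩ := ih (fun s hs => hw s (by simp [hs])) (x * a)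
      refine ⟨m a + k, le_trans ?_ (pn_add hT (m a) k x (x * a) _)⟩
      rw [mul_assoc, ← List.prod_cons] at hk
      rw [List.length_cons, pow_succ']
      exact mul_le_mul ((hε a (by simpa using hw a (by simp))).trans (hm a x)) hk (by positivity)
        (pn_nonneg hT _ _ _)
  intro x y
  obtain ⟨w, hw1, hw2, hw3⟩ := exists_geod_word hS (x⁻¹ * y)
  obtain ⟨k, hk⟩ := key w hw2 x
  rw [hw3, hw1] at hk
  rw [mul_inv_cancel_left] at hk
  exact ⟨k, hk⟩

/-! Identification with `ptrans`. -/

lemma ptrans_eq_aux (hT : Carrier S T μ) (n : ℕ) (x : Γ) :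
    (Function.support (ptrans μ n x)).Finite ∧
    ∀ f : Γ → ℝ, ∑' z, ptrans μ n x z * f z = (Pop T μ ^ n) f x := by
  classical
  induction n with
  | zero =>
    refine ⟨(Set.finite_singleton x).subset ?_, fun f => ?_⟩
    · intro y hy
      by_contra h
      apply hy
      simp only [ptrans]
      rw [if_neg]; intro h'; exact h h'.symm
    · rw [tsum_eq_single x]
      · simp [ptrans]
      · intro y hy
        simp [ptrans, hy.symm]
  | succ n ih =>
    obtain ⟨hfin, hs⟩ := ih
    have hsum : ∀ y, ptrans μ (n + 1) x y = ∑ z ∈ hfin.toFinset, ptrans μ n x z * μ (z⁻¹ * y) := by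
      intro y
      show ∑' z : Γ, ptrans μ n x z * μ (z⁻¹ * y) = _
      apply tsum_eq_sum
      intro z hz
      have : ptrans μ n x z = 0 := by simpa using hz
      rw [this, zero_mul]
    have hμT : ∀ z y, μ (z⁻¹ * y) ≠ 0 → y ∈ T.image (z * ·) := by
      intro z y h
      exact Finset.mem_image.2 ⟨_, hT.supp _ h, by simp⟩
    refine ⟨?_, fun f => ?_⟩
    · apply ((hfin.toFinset.biUnion fun z => T.image (z * ·)).finite_toSet).subset
      intro y hy
      rw [Function.mem_support, hsum] at hy
      obtain ⟨z, hz, h⟩ := Finset.exists_ne_zero_of_sum_ne_zero hy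
      exact Finset.mem_biUnion.2 ⟨z, hz, hμT z y (right_ne_zero_of_mul h)⟩
    · simp_rw [hsum, Finset.sum_mul]
      have hz : ∀ z, (∑' y, ptrans μ n x z * μ (z⁻¹ * y) * f y) =
          ptrans μ n x z * Pop T μ f z := by
        intro z
        rw [tsum_eq_sum (s := T.image (z * ·))]
        · rw [Finset.sum_image (by intro a _ b _ h; simpa using h), Pop_apply, Finset.mul_sum]
          exact Finset.sum_congr rfl fun s _ => by simp [mul_assoc]
        · intro y hy
          by_cases h : μ (z⁻¹ * y) = 0
          · rw [h]; ring
          · exact absurd (hμT z y h) hy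
      rw [Summable.tsum_finsetSum]
      · rw [Pop_pow_succ, ← hs, tsum_eq_sum (s := hfin.toFinset)]
        · exact Finset.sum_congr rfl fun z _ => hz z
        · intro z hz
          have : ptrans μ n x z = 0 := by simpa using hz
          rw [this, zero_mul]
      · intro z _
        apply summable_of_ne_finset_zero (s := T.image (z * ·))
        intro y hy
        by_cases h : μ (z⁻¹ * y) = 0
        · rw [h]; ring
        · exact absurd (hμT z y h) hy

lemma ptrans_eq (hT : Carrier S T μ) (n : ℕ) (x y : Γ) : ptrans μ n x y = pn T μ n x y := by
  unfold pn
  rw [← (ptrans_eq_aux hT n x).2, tsum_eq_single y]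
  · simp [dl_self]
  · intro z hz; simp [dl_ne hz]

/-! Minimum principle. -/

lemma min_principle (hμ : IsRWMeasure S μ) (hT : Carrier S T μ)
    (Ω : Set Γ) (hΩ : Ω ≠ Set.univ) (w : Γ → ℝ) (hw : ∀ g ∈ Ω, Pop T μ w g ≤ w g)
    (hbd : ∀ g ∈ Ω, ∀ s ∈ T, g * s ∉ Ω → 0 ≤ w (g * s))
    (hinf : ∀ ε > 0, {g ∈ Ω | w g < -ε}.Finite) : ∀ g ∈ Ω, 0 ≤ w g := by
  intro g0 hg0
  by_contra hneg
  push Not at hneg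
  have hfin := hinf (-(w g0) / 2) (by linarith)
  obtain ⟨gm, hgm, hmin⟩ := Set.exists_min_image _ w hfin ⟨g0, hg0, by linarith⟩
  have hm0 : w gm ≤ w g0 := hmin g0 ⟨hg0, by linarith⟩
  have hminΩ : ∀ g ∈ Ω, w gm ≤ w g := by
    intro g hg
    by_cases h : w g < -(-(w g0) / 2)
    · exact hmin g ⟨hg, h⟩
    · linarith
  have step : ∀ g ∈ Ω, w g = w gm → ∀ s, 0 < μ s → g * s ∈ Ω ∧ w (g * s) = w gm := by
    intro g hg hgw s hs
    have hall : ∀ s ∈ T, w gm ≤ w (g * s) := by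
      intro s hs
      by_cases h : g * s ∈ Ω
      · exact hminΩ _ h
      · have := hbd g hg s hs h; linarith
    have h1 := hw g hg
    rw [Pop_apply, hgw] at h1
    have h2 : ∑ s ∈ T, μ s * w gm = w gm := by rw [← Finset.sum_mul, hT.total, one_mul]
    have h3 : ∑ s ∈ T, μ s * (w (g * s) - w gm) ≤ 0 := by
      simp only [mul_sub, Finset.sum_sub_distrib]; linarith
    have hsT := hT.supp s hs.ne'
    have h4 := Finset.single_le_sum (f := fun s => μ s * (w (g * s) - w gm)) (s := T)
      (fun i hi => mul_nonneg (hT.nonneg i) (by linarith [hall i hi])) hsT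
    have h5 : w (g * s) = w gm := by
      have h6 := hall s hsT
      nlinarith
    refine ⟨?_, h5⟩
    by_contra h
    have := hbd g hg s hsT h
    linarith
  have chain : ∀ l : List Γ, (∀ x ∈ l, 0 < μ x) → ∀ g ∈ Ω, w g = w gm → g * l.prod ∈ Ω := by
    intro l
    induction l with
    | nil => intro _ g hg _; simpa using hg
    | cons a l ih =>
      intro hl g hg hgw
      have h1 := step g hg hgw a (hl a (by simp))
      rw [List.prod_cons, ← mul_assoc]
      exact ih (fun x hx => hl x (by simp [hx])) _ h1.1 h1.2
  apply hΩ
  rw [Set.eq_univ_iff_forall]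
  intro y
  obtain ⟨l, -, hl, e⟩ := hμ.nondeg (gm⁻¹ * y)
  have := chain l hl gm hgm.1 rfl
  rw [e] at this
  simpa using this

end
end

section

/-! ### Harmonic functions from the stationary measure -/

/-- All standing hypotheses. -/
structure Setup (S : Set Γ) (δ : ℝ) (T : Finset Γ) (μ : Γ → ℝ) (B : Boundary Γ S)
    [mB : MeasurableSpace B.pt] (ν : Measure B.pt) : Prop where
  hS : IsGenSet S
  hδ : IsHyperbolic S δ
  hne : Nonelementary Γ
  hμ : IsRWMeasure S μ
  hT : Carrier S T μ
  hmB : mB = @borel B.pt (btop B)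
  hν : IsProbabilityMeasure ν
  hstat : ∀ A : Set B.pt, MeasurableSet A →
      ν A = ∑' g : Γ, ENNReal.ofReal (μ g) * ν (B.smul g ⁻¹' A)

/-- The harmonic function `g ↦ ν(g⁻¹A)`. -/
noncomputable def hf {S : Set Γ} (B : Boundary Γ S) [MeasurableSpace B.pt] (ν : Measure B.pt)
    (A : Set B.pt) (g : Γ) : ℝ := (ν (B.smul g ⁻¹' A)).toReal

/-- Sup of the measures of shadows of depth `t`. -/
noncomputable def aa {S : Set Γ} (B : Boundary Γ S) [MeasurableSpace B.pt] (ν : Measure B.pt)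
    (t : ℝ) : ℝ := ⨆ h : Γ, (ν (Tset B 1 h t)).toReal

section
variable {S : Set Γ} {δ : ℝ} {T : Finset Γ} {μ : Γ → ℝ} {B : Boundary Γ S}
    [mB : MeasurableSpace B.pt] {ν : Measure B.pt}

lemma Setup.open_meas (H : Setup S δ T μ B ν) {O : Set B.pt} (hO : @IsOpen B.pt (btop B) O) :
    MeasurableSet O := by
  have h := H.hmB
  subst h
  exact MeasurableSpace.measurableSet_generateFrom hO

lemma Setup.Wset_meas (H : Setup S δ T μ B ν) (h : Γ) (s : ℝ) : MeasurableSet (Wset B h s) :=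
  H.open_meas (Wset_open H.hS H.hδ B h s)

lemma Setup.smul_meas (H : Setup S δ T μ B ν) {A : Set B.pt} (hA : MeasurableSet A) (g : Γ) :
    MeasurableSet (B.smul g ⁻¹' A) := by
  have hm : Measurable (B.smul g) := by
    have h := H.hmB
    have hS := H.hS
    have hδ := H.hδ
    clear hA
    subst h
    refine @measurable_generateFrom _ _ (@borel B.pt (btop B)) _ _ ?_
    intro O hO
    exact MeasurableSpace.measurableSet_generateFrom (smul_continuous hS hδ B g O hO)
  exact hm hA

lemma Setup.fin (H : Setup S δ T μ B ν) (A : Set B.pt) : ν A ≠ ∞ := by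
  have := H.hν
  exact measure_ne_top ν A

lemma Setup.le_one (H : Setup S δ T μ B ν) (A : Set B.pt) : (ν A).toReal ≤ 1 := by
  have := H.hν
  exact ENNReal.toReal_le_of_le_ofReal zero_le_one (by simpa using prob_le_one)

lemma Setup.mono (H : Setup S δ T μ B ν) {A A' : Set B.pt} (h : A ⊆ A') :
    (ν A).toReal ≤ (ν A').toReal :=
  ENNReal.toReal_mono (H.fin A') (measure_mono h)

lemma hf_nonneg (A : Set B.pt) (g : Γ) : 0 ≤ hf B ν A g := ENNReal.toReal_nonneg

lemma Setup.hf_le_one (H : Setup S δ T μ B ν) (A : Set B.pt) (g : Γ) : hf B ν A g ≤ 1 := H.le_one _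

lemma Setup.hf_mono (H : Setup S δ T μ B ν) {A A' : Set B.pt} (h : A ⊆ A') (g : Γ) :
    hf B ν A g ≤ hf B ν A' g := H.mono (Set.preimage_mono h)

lemma hf_one (A : Set B.pt) : hf B ν A 1 = (ν A).toReal := by
  unfold hf
  congr 2
  ext η
  simp [smul_one]

lemma Setup.hf_harm (H : Setup S δ T μ B ν) {A : Set B.pt} (hA : MeasurableSet A) :
    Pop T μ (hf B ν A) = hf B ν A := by
  funext g
  rw [Pop_apply]
  unfold hf
  rw [H.hstat _ (H.smul_meas hA g), tsum_eq_sum (s := T)]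
  · rw [ENNReal.toReal_sum]
    · refine Finset.sum_congr rfl fun s _ => ?_
      rw [ENNReal.toReal_mul, ENNReal.toReal_ofReal (H.hT.nonneg s)]
      congr 3
      ext η
      simp [smul_mul H.hS]
    · intro s _
      exact ENNReal.mul_ne_top ENNReal.ofReal_ne_top (H.fin _)
  · intro s hs
    have : μ s = 0 := by
      by_contra h
      exact hs (H.hT.supp s h)
    simp [this]

lemma Setup.aa_bdd (H : Setup S δ T μ B ν) (t : ℝ) :
    BddAbove (Set.range fun h : Γ => (ν (Tset B 1 h t)).toReal) :=
  ⟨1, by rintro _ ⟨h, rfl⟩; exact H.le_one _⟩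

lemma Setup.le_aa (H : Setup S δ T μ B ν) {A : Set B.pt} {h : Γ} {t : ℝ} (hA : A ⊆ Tset B 1 h t) :
    (ν A).toReal ≤ aa B ν t :=
  (H.mono hA).trans (le_ciSup (H.aa_bdd t) h)

lemma Setup.hf_le_aa (H : Setup S δ T μ B ν) {A : Set B.pt} {g h : Γ} {t : ℝ}
    (hA : A ⊆ Tset B g h t) : hf B ν A g ≤ aa B ν t :=
  H.le_aa ((Set.preimage_mono hA).trans (preimage_Tset H.hS g h t))

lemma Setup.hf_compl (H : Setup S δ T μ B ν) {A : Set B.pt} (hA : MeasurableSet A) (g : Γ) :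
    hf B ν Aᶜ g = 1 - hf B ν A g := by
  have := H.hν
  unfold hf
  rw [Set.preimage_compl]
  exact probReal_compl_eq_one_sub (H.smul_meas hA g)

lemma Setup.hf_ge_aa (H : Setup S δ T μ B ν) {A : Set B.pt} (hm : MeasurableSet A) {g h : Γ} {t : ℝ}
    (hA : Aᶜ ⊆ Tset B g h t) : 1 - aa B ν t ≤ hf B ν A g := by
  have h1 := H.hf_le_aa hA
  rw [H.hf_compl hm] at h1
  linarith

lemma Setup.aa_anti (H : Setup S δ T μ B ν) {s t : ℝ} (h : s ≤ t) : aa B ν t ≤ aa B ν s :=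
  ciSup_le fun k => H.le_aa (Tset_anti B 1 k h)

lemma Setup.aa_nonneg (H : Setup S δ T μ B ν) (t : ℝ) : 0 ≤ aa B ν t :=
  ENNReal.toReal_nonneg.trans (H.le_aa (subset_refl (Tset B 1 1 t)))

lemma Setup.aa_le_one (H : Setup S δ T μ B ν) (t : ℝ) : aa B ν t ≤ 1 :=
  ciSup_le fun _ => H.le_one _

/-- A harmonic function attaining its maximum at `1` is constant. -/
lemma harm_max (hμ : IsRWMeasure S μ) (hT : Carrier S T μ) {f : Γ → ℝ} (hf : Pop T μ f = f)
    {M : ℝ} (hM : ∀ g, f g ≤ M) (h1 : f 1 = M) (g : Γ) : f g = M := by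
  obtain ⟨l, _, hl, hg⟩ := hμ.nondeg g
  obtain ⟨c, hc, hcl⟩ := pn_list hT l hl
  have h2 := hcl 1
  rw [one_mul, hg] at h2
  have h3 := le_of_dl hT l.length 1 g (f := (fun _ => M) - f) (fun z => by simpa using hM z)
  rw [map_sub] at h3
  simp only [Pi.sub_apply, Pop_const hT, Pop_fix hf] at h3
  have := hM g
  nlinarith

lemma inter_ray (hS : IsGenSet S) (hδ : IsHyperbolic S δ) {x : ℕ → Γ} {ξ : B.pt} (hx : RayTo B x ξ) :
    ⋂ r : ℕ, Wset B (x r) (r - 3 * δ) = {ξ} := by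
  have h0 := hδ.1
  ext η
  simp only [Set.mem_iInter, Set.mem_singleton_iff]
  constructor
  · intro h
    obtain ⟨v, hv⟩ := exists_rep B η
    rw [← hv.2, ← hx.2.2, eq_comm, B.cls_eq x v hx.2.1 hv.1, equivSeq_iff]
    intro C
    obtain ⟨r, hr⟩ := exists_nat_ge (C + 5 * δ)
    obtain ⟨N, hN⟩ := Tset_all hS hδ (Wset_sub B _ _ (h r)) hv
    refine ⟨max N r, fun i hi j hj => ?_⟩
    have h1 := ray_gp hx.1 (le_trans (le_max_right N r) hi)
    rw [gp_comm hS] at h1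
    have h2 := hN j (le_trans (le_max_left N r) hj)
    have := hyp_ge hS hδ 1 (x i) (x r) (v j) (r - 3 * δ - δ) (by linarith) h2
    linarith
  · rintro rfl r
    apply Wset_sup hS hδ
    refine ⟨x, ⟨hx.2.1, hx.2.2⟩, r, fun n hn => ?_⟩
    rw [ray_gp hx.1 hn]; linarith

lemma Setup.singleton_meas (H : Setup S δ T μ B ν) (η : B.pt) : MeasurableSet ({η} : Set B.pt) := by
  obtain ⟨x, hx⟩ := exists_ray H.hS H.hδ B η
  rw [← inter_ray H.hS H.hδ hx]
  exact MeasurableSet.iInter fun r => H.Wset_meas _ _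

lemma Setup.no_atom_orbit (H : Setup S δ T μ B ν) (ξ : B.pt) (c : ℝ) (hc : 0 < c)
    (h : ∀ g, c ≤ hf B ν {ξ} g) : False := by
  have := H.hν
  have : MeasurableSingletonClass B.pt := ⟨H.singleton_meas⟩
  have hpre : ∀ g, B.smul g⁻¹ ⁻¹' {ξ} = {B.smul g ξ} := by
    intro g; ext η
    simp only [Set.mem_preimage, Set.mem_singleton_iff]
    constructor
    · rintro rfl; rw [← smul_mul H.hS, mul_inv_cancel, smul_one]
    · rintro rfl; rw [← smul_mul H.hS, inv_mul_cancel, smul_one]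
  have hfin : (Set.range fun g => B.smul g ξ).Finite := by
    by_contra hinf
    have h1 := Set.Infinite.meas_eq_top (μ := ν) hinf ⟨ENNReal.ofReal c, by simpa using hc, by
      rintro _ ⟨g, rfl⟩
      rw [← hpre g]
      exact ENNReal.ofReal_le_of_le_toReal (h g⁻¹)⟩
    exact H.fin _ h1
  obtain ⟨F, -, hF, hF2⟩ := Set.exists_subset_image_finite_and
    (f := fun g => B.smul g ξ) (s := Set.univ) (p := fun s => s = Set.range fun g => B.smul g ξ) |>.1
      ⟨_, by rw [Set.image_univ], hfin, rfl⟩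
  refine no_finite_orbit H.hS H.hδ H.hne B ξ F hF fun g => ?_
  have : B.smul g ξ ∈ (fun g => B.smul g ξ) '' F := by rw [hF2]; exact ⟨g, rfl⟩
  obtain ⟨t, ht, h⟩ := this
  exact ⟨t, ht, h.symm⟩

lemma Setup.aa_small (H : Setup S δ T μ B ν) (ε : ℝ) (hε : 0 < ε) : ∃ t, aa B ν t ≤ ε := by
  by_contra hcon
  push Not at hcon
  have h0 := H.hδ.1
  set a := ⨅ n : ℕ, aa B ν n with ha
  have hbdd : BddBelow (Set.range fun n : ℕ => aa B ν n) := ⟨0, by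
    rintro _ ⟨n, rfl⟩; exact H.aa_nonneg _⟩
  have hapos : 0 < a := hε.trans_le (le_ciInf fun n => (hcon n).le)
  have hex : ∀ n : ℕ, ∃ h, a - a * (1 / ((n : ℝ) + 1)) < (ν (Tset B 1 h n)).toReal := by
    intro n
    apply exists_lt_of_lt_ciSup
    apply lt_of_lt_of_le _ (ciInf_le hbdd n)
    have : 0 < a * (1 / ((n : ℝ) + 1)) := by positivity
    linarith
  choose h hh using hex
  have hlen : ∀ n, n ≤ wl S (h n) := by
    intro n
    have h1 : 0 < (ν (Tset B 1 (h n) n)).toReal := by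
      apply lt_of_le_of_lt _ (hh n)
      have : 1 / ((n : ℝ) + 1) ≤ 1 := by
        rw [div_le_one (by positivity)]; have : (0:ℝ) ≤ n := by positivity
        linarith
      nlinarith
    have h2 : (Tset B 1 (h n) n).Nonempty := by
      by_contra h3
      rw [Set.not_nonempty_iff_eq_empty] at h3
      simp [h3] at h1
    obtain ⟨η, u, hu, N, hN⟩ := h2
    have := (hN N le_rfl).trans (gp_le_left H.hS _ _ _)
    rw [wdist_comm H.hS, wdist_one] at this
    exact_mod_cast this
  have hat : (hyperfilter ℕ : Filter ℕ) ≤ atTop := Nat.hyperfilter_le_atTop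
  obtain ⟨x, hx, hxh⟩ := exists_limit_ray H.hS h (fun C => by
    filter_upwards [hat (eventually_ge_atTop C)] with n hn
    exact hn.trans (hlen n))
  have hray : RayTo B x (B.cls x) := ⟨hx, ray_convInf H.hS hx, rfl⟩
  have hsub : ∀ r : ℕ, ∀ᶠ n in (hyperfilter ℕ : Filter ℕ),
      Tset B 1 (h n) n ⊆ Wset B (x r) (r - 3 * δ) := by
    intro r
    filter_upwards [hxh r, hat (eventually_ge_atTop r)] with n h1 h2
    rintro η ⟨u, hu, N, hN⟩
    apply Wset_sup H.hS H.hδ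
    refine ⟨u, hu, N, fun k hk => ?_⟩
    have h2' : (r : ℝ) ≤ n := by exact_mod_cast h2
    have := hyp_ge H.hS H.hδ 1 (x r) (h n) (u k) r h1.ge (h2'.trans (hN k hk))
    linarith
  have hM : ∀ r : ℕ, a ≤ (ν (⋂ j ≤ r, Wset B (x j) (j - 3 * δ))).toReal := by
    intro r
    have hall : ∀ᶠ n in (hyperfilter ℕ : Filter ℕ), ∀ j ∈ Set.Iic r,
        Tset B 1 (h n) n ⊆ Wset B (x j) (j - 3 * δ) :=
      (Filter.eventually_all_finite (Set.finite_Iic r)).2 fun j _ => hsub j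
    have hlim : Tendsto (fun n : ℕ => a - a * (1 / ((n : ℝ) + 1))) (hyperfilter ℕ) (𝓝 (a - a * 0)) :=
      ((tendsto_one_div_add_atTop_nhds_zero_nat.const_mul a).const_sub a).mono_left hat
    rw [mul_zero, sub_zero] at hlim
    refine le_of_tendsto hlim ?_
    filter_upwards [hall] with n hn
    exact (hh n).le.trans (H.mono (Set.subset_iInter₂ hn))
  have hlimM := tendsto_measure_iInter_le (μ := ν) (f := fun j : ℕ => Wset B (x j) (j - 3 * δ))
    (fun j => (H.Wset_meas _ _).nullMeasurableSet) ⟨0, H.fin _⟩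
  rw [inter_ray H.hS H.hδ hray] at hlimM
  have hatom : a ≤ (ν {B.cls x}).toReal :=
    ge_of_tendsto' ((ENNReal.tendsto_toReal (H.fin _)).comp hlimM) hM
  have hle : ∀ g, hf B ν {B.cls x} g ≤ a := by
    intro g
    refine le_ciInf fun n => ?_
    have : B.smul g ⁻¹' {B.cls x} ⊆ {B.smul g⁻¹ (B.cls x)} := by
      intro η hη
      rw [Set.mem_preimage, Set.mem_singleton_iff] at hη
      rw [Set.mem_singleton_iff, ← hη, ← smul_mul H.hS, inv_mul_cancel, smul_one]
    obtain ⟨k, hk⟩ := exists_mem_Tset B (B.smul g⁻¹ (B.cls x)) n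
    exact H.le_aa (this.trans (Set.singleton_subset_iff.2 hk))
  have h1 : hf B ν {B.cls x} 1 = a := le_antisymm (hle 1) (by rw [hf_one]; exact hatom)
  have hconst := harm_max H.hμ H.hT (H.hf_harm (H.singleton_meas _)) hle h1
  exact H.no_atom_orbit _ a hapos fun g => (hconst g).ge

end
end

section

/-! ### Exponential decay of shadows -/
section
variable {S : Set Γ} {δ : ℝ} {T : Finset Γ} {μ : Γ → ℝ} {B : Boundary Γ S}
    [mB : MeasurableSpace B.pt] {ν : Measure B.pt}

lemma Wset_compl (hS : IsGenSet S) (hδ : IsHyperbolic S δ) (B : Boundary Γ S) (h y : Γ) (t c : ℝ)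
    (hc : 4 * δ ≤ c) (hy : t ≤ gp S 1 y h) :
    (Wset B h (t - c))ᶜ ⊆ Tset B y 1 (c - 4 * δ) := by
  intro η hη
  have h1 : η ∉ Tset B 1 h (t - c + 2 * δ) := fun h' => hη (Wset_sup hS hδ B h _ h')
  obtain ⟨v, hv⟩ := exists_rep B η
  obtain ⟨N, hN⟩ := notTset_all hS hδ h1 hv
  refine ⟨v, hv, N, fun n hn => ?_⟩
  have h2 := hN n hn
  have h3 : gp S 1 y (v n) < t - c + 4 * δ := by
    by_contra h4
    push Not at h4
    have := hyp_ge hS hδ 1 h y (v n) (t - c + 4 * δ) (by rw [gp_comm hS]; linarith) h4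
    linarith
  rw [gp_swap hS y 1]
  have := gp_le_left hS 1 y h
  linarith

lemma Tset_move (hS : IsGenSet S) (hδ : IsHyperbolic S δ) (B : Boundary Γ S) (h g : Γ) (s τ : ℝ)
    (hg : gp S 1 g h ≤ τ) (hs : τ + δ < s) :
    Tset B 1 h s ⊆ Tset B g h (wdist S g 1 + s - 2 * τ - δ) := by
  rintro η ⟨u, hu, N, hN⟩
  refine ⟨u, hu, N, fun n hn => ?_⟩
  have h1 := hN n hn
  have h3 : gp S 1 (u n) g ≤ τ + δ := by
    by_contra h4
    push Not at h4
    have h6 : τ + δ < min (gp S 1 (u n) g) (gp S 1 h (u n)) := lt_min h4 (by linarith)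
    have h5 := hyp_ge hS hδ 1 g (u n) h (min (gp S 1 (u n) g) (gp S 1 h (u n)))
      (by rw [gp_comm hS]; exact min_le_left _ _) (by rw [gp_comm hS _ (u n) h]; exact min_le_right _ _)
    linarith
  rw [gp_change hS g 1, gp_comm hS 1 h g]
  linarith

lemma Setup.W_half (H : Setup S δ T μ B ν) : ∃ c : ℝ, 0 < c ∧ 4 * δ ≤ c ∧
    ∀ (h y : Γ) (t : ℝ), t ≤ gp S 1 y h → 1 / 2 ≤ hf B ν (Wset B h (t - c)) y := by
  obtain ⟨t0, ht0⟩ := H.aa_small (1 / 2) (by norm_num)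
  have h0 := H.hδ.1
  have hc : 4 * δ ≤ max t0 0 + 1 + 4 * δ := by linarith [le_max_right t0 0]
  refine ⟨max t0 0 + 1 + 4 * δ, by linarith [le_max_right t0 0], hc, fun h y t hy => ?_⟩
  have h1 := H.hf_ge_aa (H.Wset_meas h _) (Wset_compl H.hS H.hδ B h y t _ hc hy)
  have h2 := H.aa_anti (s := t0) (t := max t0 0 + 1 + 4 * δ - 4 * δ) (by linarith [le_max_left t0 0])
  linarith

lemma Setup.aa_mul (H : Setup S δ T μ B ν) : ∃ L : ℝ, 0 < L ∧ ∀ t : ℝ, 0 ≤ t →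
    aa B ν (t + L) ≤ 1 / 2 * aa B ν t := by
  have h0 := H.hδ.1
  obtain ⟨c, hc0, hc, hhalf⟩ := H.W_half
  obtain ⟨t0, ht0⟩ := H.aa_small (1 / 4) (by norm_num)
  set τ := max t0 0 + 2 + δ with hτ
  have hm1 := le_max_left t0 0
  have hm2 := le_max_right t0 0
  have hτa : aa B ν (τ - 2 - δ) ≤ 1 / 4 := (H.aa_anti (by linarith)).trans ht0
  refine ⟨τ + 2 * δ + c, by linarith, fun t' ht' => ?_⟩
  obtain ⟨t, rfl⟩ : ∃ t, t' = t - c := ⟨t' + c, by ring⟩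
  have htpos : 0 < t := by linarith
  have ha0 := H.aa_nonneg (t - c)
  apply ciSup_le
  intro h
  by_cases hlen : t ≤ wl S h
  swap
  · have : Tset B 1 h (t - c + (τ + 2 * δ + c)) = ∅ := by
      rw [Set.eq_empty_iff_forall_notMem]
      rintro η ⟨u, hu, N, hN⟩
      have := (hN N le_rfl).trans (gp_le_left H.hS _ _ _)
      rw [wdist_comm H.hS, wdist_one] at this
      push Not at hlen
      linarith
    rw [this]; simp; linarith
  have hsub : Tset B 1 h (t - c + (τ + 2 * δ + c)) ⊆ Wset B h (t + τ) := by
    have : t - c + (τ + 2 * δ + c) = t + τ + 2 * δ := by ring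
    rw [this]; exact Wset_sup H.hS H.hδ B h _
  refine (H.mono hsub).trans ?_
  set A := Wset B h (t + τ) with hA
  set A' := Wset B h (t - c) with hA'
  have hmin := min_principle H.hμ H.hT {g | gp S 1 g h < t} (by
      intro hu
      have : h ∈ {g | gp S 1 g h < t} := by rw [hu]; trivial
      rw [Set.mem_setOf_eq, gp_self, wdist_comm H.hS, wdist_one] at this
      linarith) ((1 / 2 : ℝ) • hf B ν A' - hf B ν A) (by
      intro g _
      rw [map_sub, map_smul, H.hf_harm (H.Wset_meas _ _), H.hf_harm (H.Wset_meas _ _)]) (by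
      intro g hg s hs hgs
      simp only [Set.mem_setOf_eq, not_lt] at hg hgs
      have hstep : gp S 1 (g * s) h ≤ t + 1 := by
        have h1 := gp_lip H.hS 1 h (g * s) g
        have h2 := wdist_mul_gen (H.hT.sub s hs) g
        rw [wdist_comm H.hS] at h2
        have h2' : (wdist S (g * s) g : ℝ) ≤ 1 := by exact_mod_cast h2
        rw [gp_comm H.hS, gp_comm H.hS 1 h g] at h1
        linarith
      have h1 := hhalf h (g * s) t hgs
      have h2 := H.hf_le_aa ((Wset_sub B h (t + τ)).trans (Tset_move H.hS H.hδ B h (g * s) (t + τ) (t + 1)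
        hstep (by linarith)))
      have h3 := gp_le_left H.hS 1 (g * s) h
      have h4 := H.aa_anti (s := τ - 2 - δ) (t := wdist S (g * s) 1 + (t + τ) - 2 * (t + 1) - δ)
        (by linarith)
      simp only [Pi.sub_apply, Pi.smul_apply, smul_eq_mul]
      linarith) (by
      intro ε hε
      obtain ⟨t1, ht1⟩ := H.aa_small ε hε
      apply (wball_finite H.hS ⌈t1 + t + δ⌉₊).subset
      rintro g ⟨hg, hw⟩
      rw [Set.mem_setOf_eq] at hg
      simp only [Pi.sub_apply, Pi.smul_apply, smul_eq_mul] at hw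
      have h5 := hf_nonneg (ν := ν) A' g
      have h2 := H.hf_le_aa ((Wset_sub B h (t + τ)).trans (Tset_move H.hS H.hδ B h g (t + τ) t
        hg.le (by linarith)))
      by_contra hgl
      rw [Set.mem_setOf_eq, not_le] at hgl
      have h6 : t1 + t + δ < wl S g := (Nat.le_ceil _).trans_lt (by exact_mod_cast hgl)
      rw [wdist_comm H.hS, wdist_one] at h2
      have h4 := H.aa_anti (s := t1) (t := wl S g + (t + τ) - 2 * t - δ) (by linarith)
      linarith) 1 (by
      rw [Set.mem_setOf_eq]
      have := gp_le_left H.hS 1 1 h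
      rw [wdist_self] at this
      push_cast at this
      linarith)
  simp only [Pi.sub_apply, Pi.smul_apply, smul_eq_mul, hf_one] at hmin
  have := H.le_aa (Wset_sub B h (t - c))
  linarith

lemma Setup.aa_exp (H : Setup S δ T μ B ν) : ∃ C κ₀ : ℝ, 1 ≤ C ∧ 0 < κ₀ ∧
    ∀ κ, 0 < κ → κ ≤ κ₀ → ∀ t : ℝ, aa B ν t ≤ C * Real.exp (-κ * t) := by
  obtain ⟨L, hL, hmul⟩ := H.aa_mul
  have hn : ∀ n : ℕ, aa B ν (n * L) ≤ (1 / 2) ^ n := by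
    intro n
    induction n with
    | zero => simpa using H.aa_le_one 0
    | succ n ih =>
      have := hmul (n * L) (by positivity)
      push_cast
      rw [add_mul, one_mul, pow_succ]
      linarith
  refine ⟨2, Real.log 2 / L, by norm_num, div_pos (Real.log_pos (by norm_num)) hL, fun κ hκ hκ0 t => ?_⟩
  rcases lt_or_ge t 0 with ht | ht
  · have h1 := H.aa_le_one t
    have h2 : 1 ≤ Real.exp (-κ * t) := Real.one_le_exp (by nlinarith)
    linarith
  have h1 : aa B ν t ≤ (1 / 2) ^ ⌊t / L⌋₊ := by
    refine (H.aa_anti ?_).trans (hn ⌊t / L⌋₊)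
    have := Nat.floor_le (div_nonneg ht hL.le)
    rwa [le_div_iff₀ hL] at this
  refine h1.trans ?_
  have h2 := (Nat.lt_floor_add_one (t / L))
  set k := ⌊t / L⌋₊
  have h3 : ((1:ℝ) / 2) ^ k = 2 * Real.exp (-(Real.log 2) * (k + 1)) := by
    have : -(Real.log 2) * ((k:ℝ) + 1) = ((k + 1 : ℕ) : ℝ) * (-Real.log 2) := by push_cast; ring
    rw [this, Real.exp_nat_mul, Real.exp_neg, Real.exp_log (by norm_num), pow_succ]
    ring
  rw [h3]
  have h4 : -(Real.log 2) * (k + 1) ≤ -κ * t := by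
    have h5 : κ * t ≤ Real.log 2 / L * t := mul_le_mul_of_nonneg_right hκ0 ht
    have h6 : Real.log 2 / L * t = Real.log 2 * (t / L) := by ring
    have h7 : Real.log 2 * (t / L) ≤ Real.log 2 * (k + 1) :=
      mul_le_mul_of_nonneg_left h2.le (Real.log_pos (by norm_num)).le
    linarith
  have := Real.exp_le_exp.2 h4
  linarith

end
end

section

/-! ### Transience and drift -/
section
variable {S : Set Γ} {δ : ℝ} {T : Finset Γ} {μ : Γ → ℝ} {B : Boundary Γ S}
    [mB : MeasurableSpace B.pt] {ν : Measure B.pt}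

lemma Setup.exists_long (H : Setup S δ T μ B ν) (n : ℕ) : ∃ h, wl S h = n := by
  have := H.hν
  obtain ⟨η⟩ : Nonempty B.pt := by
    by_contra hne
    rw [not_nonempty_iff] at hne
    have h1 : ν Set.univ = 1 := measure_univ
    rw [Set.univ_eq_empty_iff.2 hne] at h1
    simp at h1
  obtain ⟨x, hx⟩ := exists_ray H.hS H.hδ B η
  refine ⟨x n, ?_⟩
  have := hx.1.2 0 n
  rw [hx.1.1, wdist_one] at this
  simpa [Nat.dist] using this

lemma Setup.nonconst (H : Setup S δ T μ B ν) : ∃ f : Γ → ℝ, Pop T μ f = f ∧ (∀ g, 0 ≤ f g) ∧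
    (∀ g, f g ≤ 1) ∧ ∃ k, f k ≠ f 1 := by
  obtain ⟨c, hc0, hc, hhalf⟩ := H.W_half
  obtain ⟨t0, ht0⟩ := H.aa_small (1 / 4) (by norm_num)
  obtain ⟨h, hh⟩ := H.exists_long ⌈t0 + c⌉₊
  refine ⟨hf B ν (Wset B h (t0 + c - c)), H.hf_harm (H.Wset_meas _ _), fun g => hf_nonneg _ _,
    fun g => H.hf_le_one _ _, h, ?_⟩
  have h1 := hhalf h h (t0 + c) (by
    rw [gp_self, wdist_comm H.hS, wdist_one, hh]; exact Nat.le_ceil _)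
  have h2 := H.le_aa (Wset_sub B h (t0 + c - c))
  rw [hf_one]
  rw [add_sub_cancel_right] at *
  linarith

lemma var_eq (hT : Carrier S T μ) {f : Γ → ℝ} (hf : Pop T μ f = f) (m : ℕ) (g : Γ) (a : ℝ) :
    (Pop T μ ^ m) (fun y => (f y - a) ^ 2) g = (Pop T μ ^ m) (fun y => f y ^ 2) g
      - 2 * a * f g + a ^ 2 := by
  have : (fun y => (f y - a) ^ 2) = (fun y => f y ^ 2) - (2 * a) • f + (fun _ => a ^ 2) := by
    funext y; simp; ring
  rw [this, map_add, map_sub, map_smul, Pop_fix hf]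
  simp [Pop_const hT]

lemma Setup.pn_summable (H : Setup S δ T μ B ν) (g : Γ) : Summable fun N => pn T μ N 1 g := by
  obtain ⟨f, hf, hf0, hf1, k0, hk0⟩ := H.nonconst
  obtain ⟨k, hk⟩ : ∃ k, f k ≠ f g := by
    by_cases h : f g = f 1
    · exact ⟨k0, by rwa [h]⟩
    · exact ⟨1, fun h' => h h'.symm⟩
  obtain ⟨l, _, hl, hgl⟩ := H.hμ.nondeg (g⁻¹ * k)
  obtain ⟨c, hc, hcl⟩ := pn_list H.hT l hl
  have h2 := hcl g
  rw [hgl, mul_inv_cancel_left] at h2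
  set m := l.length
  set q : Γ → ℝ := fun y => f y ^ 2 with hq
  set Φ : Γ → ℝ := (Pop T μ ^ m) q - q with hΦ
  have hΦe : ∀ y, Φ y = (Pop T μ ^ m) (fun z => (f z - f y) ^ 2) y := by
    intro y
    rw [var_eq H.hT hf]
    simp only [hΦ, hq, Pi.sub_apply]; ring
  have hΦ0 : ∀ y, 0 ≤ Φ y := fun y => by
    rw [hΦe]; exact Pop_nonneg H.hT m (fun z => sq_nonneg _) y
  have hΦg : 0 < Φ g := by
    rw [hΦe]
    have h3 := le_of_dl H.hT m g k (f := fun z => (f z - f g) ^ 2) (fun z => sq_nonneg _)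
    have h4 : 0 < (f k - f g) ^ 2 := by
      have : f k - f g ≠ 0 := sub_ne_zero.2 hk
      positivity
    have : 0 < pn T μ m g k * (f k - f g) ^ 2 := mul_pos (hc.trans_le h2) h4
    exact this.trans_le h3
  have hq0 : ∀ n, 0 ≤ (Pop T μ ^ n) q 1 := fun n => Pop_nonneg H.hT n (fun y => sq_nonneg _) 1
  have hq1 : ∀ n, (Pop T μ ^ n) q 1 ≤ 1 := fun n => by
    rw [← Pop_const H.hT n 1 (1 : Γ)]
    exact Pop_mono H.hT n (fun y => by
      have := hf0 y; have := hf1 y; simp only [hq]; nlinarith) 1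
  have hsum : ∀ n, ∑ N ∈ Finset.range n, (Pop T μ ^ N) Φ 1 =
      ∑ i ∈ Finset.range m, ((Pop T μ ^ (n + i)) q 1 - (Pop T μ ^ i) q 1) := by
    intro n
    induction n with
    | zero => simp
    | succ n ih =>
      rw [Finset.sum_range_succ, ih, hΦ, map_sub, ← Pop_pow_add, Pi.sub_apply]
      simp only [Finset.sum_sub_distrib]
      have h5 := Finset.sum_range_succ' (fun i => (Pop T μ ^ (n + i)) q 1) m
      rw [Finset.sum_range_succ] at h5
      have h6 : ∀ i, n + 1 + i = n + (i + 1) := fun i => by ring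
      simp only [h6]
      rw [add_zero] at h5
      linarith
  refine summable_of_sum_range_le (c := m / Φ g) (fun n => pn_nonneg H.hT n 1 g) fun n => ?_
  rw [le_div_iff₀ hΦg, Finset.sum_mul]
  calc ∑ N ∈ Finset.range n, pn T μ N 1 g * Φ g ≤ ∑ N ∈ Finset.range n, (Pop T μ ^ N) Φ 1 :=
        Finset.sum_le_sum fun N _ => le_of_dl H.hT N 1 g hΦ0
    _ ≤ ∑ i ∈ Finset.range m, (1 : ℝ) := by
        rw [hsum]
        exact Finset.sum_le_sum fun i _ => by linarith [hq0 i, hq1 (n + i)]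
    _ = m := by simp

lemma Setup.drift (H : Setup S δ T μ B ν) (M : ℕ) :
    ∃ N, (M : ℝ) ≤ (Pop T μ ^ N) (fun g => (wl S g : ℝ)) 1 := by
  classical
  set K := (wball_finite H.hS (2 * M)).toFinset with hK
  have hlim : Tendsto (fun N => ∑ g ∈ K, pn T μ N 1 g) atTop (𝓝 (∑ g ∈ K, (0 : ℝ))) :=
    tendsto_finsetSum _ fun g _ => (H.pn_summable g).tendsto_atTop_zero
  rw [Finset.sum_const_zero] at hlim
  obtain ⟨N, hN⟩ := (hlim.eventually (gt_mem_nhds (show (0:ℝ) < 1 / 2 by norm_num))).exists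
  refine ⟨N, ?_⟩
  have h1 := Pop_mono H.hT N (f := (2 * M : ℝ) • ((fun _ => 1) - ∑ g ∈ K, dl g))
    (h := fun g => (wl S g : ℝ)) (by
      intro y
      simp only [Pi.smul_apply, Pi.sub_apply, Finset.sum_apply, smul_eq_mul]
      have hnn : 0 ≤ ∑ g ∈ K, dl g y := Finset.sum_nonneg fun g _ => dl_nonneg g y
      by_cases hy : y ∈ K
      · have := Finset.single_le_sum (f := fun g => dl g y) (s := K) (fun g _ => dl_nonneg g y) hy
        simp only [dl_self] at this
        have h3 : (0:ℝ) ≤ M := by positivity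
        have h4 : (0:ℝ) ≤ wl S y := by positivity
        nlinarith
      · have h5 : 2 * M < wl S y := by simpa [hK] using hy
        have h5' : (2 * M : ℝ) < wl S y := by exact_mod_cast h5
        have h3 : (0:ℝ) ≤ M := by positivity
        nlinarith) 1
  rw [map_smul, map_sub, map_sum] at h1
  simp only [Pi.smul_apply, Pi.sub_apply, Finset.sum_apply, smul_eq_mul, Pop_const H.hT] at h1
  have h2 : ∑ g ∈ K, (Pop T μ ^ N) (dl g) 1 < 1 / 2 := hN
  have h3 : (0:ℝ) ≤ M := by positivity
  nlinarith

lemma Setup.gp_mean (H : Setup S δ T μ B ν) : ∃ C : ℝ, 0 ≤ C ∧ ∀ N h,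
    (Pop T μ ^ N) (fun g => gp S 1 g h) 1 ≤ C := by
  obtain ⟨C, κ₀, hC, hκ, hexp⟩ := H.aa_exp
  obtain ⟨c, hc0, hc, hhalf⟩ := H.W_half
  set r := Real.exp (-κ₀) with hr
  have hr1 : r < 1 := by rw [hr, Real.exp_lt_one_iff]; linarith
  have hr0 : 0 ≤ r := (Real.exp_pos _).le
  refine ⟨2 * (C * Real.exp (κ₀ * c)) * (1 - r)⁻¹, by
    have : 0 < 1 - r := by linarith
    positivity, fun N h => ?_⟩
  set Hf : ℕ → Γ → ℝ := fun t => hf B ν (Wset B h (t - c))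
  have h1 := Pop_mono H.hT N (f := fun g => gp S 1 g h)
    (h := (2 : ℝ) • ∑ t ∈ Finset.range (wl S h + 1), Hf t) (by
      intro g
      simp only [Pi.smul_apply, Finset.sum_apply, smul_eq_mul]
      have hg0 := gp_nonneg H.hS 1 g h
      have hgl : ⌊gp S 1 g h⌋₊ ≤ wl S h := by
        apply Nat.floor_le_of_le
        have := gp_le_right H.hS 1 g h
        rwa [wdist_comm H.hS, wdist_one] at this
      have h2 : ∑ t ∈ Finset.range (⌊gp S 1 g h⌋₊ + 1), (1 / 2 : ℝ) ≤
          ∑ t ∈ Finset.range (wl S h + 1), Hf t g := by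
        refine (Finset.sum_le_sum (g := fun t => Hf t g) fun t ht => ?_).trans
          (Finset.sum_le_sum_of_subset_of_nonneg (Finset.range_mono (by omega))
            fun t _ _ => hf_nonneg _ _)
        apply hhalf
        rw [Finset.mem_range] at ht
        exact (Nat.cast_le.2 (by omega : t ≤ ⌊gp S 1 g h⌋₊)).trans (Nat.floor_le hg0)
      rw [Finset.sum_const, Finset.card_range, nsmul_eq_mul] at h2
      have h3 := Nat.lt_floor_add_one (gp S 1 g h)
      push_cast at h2
      linarith) 1
  refine h1.trans ?_
  rw [map_smul, map_sum]
  simp only [Pi.smul_apply, Finset.sum_apply, smul_eq_mul]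
  have h4 : ∀ t : ℕ, (Pop T μ ^ N) (Hf t) 1 ≤ C * Real.exp (κ₀ * c) * r ^ t := by
    intro t
    rw [Pop_fix (H.hf_harm (H.Wset_meas _ _)), hf_one]
    refine (H.le_aa (Wset_sub B h _)).trans ((hexp κ₀ hκ le_rfl _).trans (le_of_eq ?_))
    rw [hr, ← Real.exp_nat_mul, mul_assoc, ← Real.exp_add]
    ring_nf
  have h5 : ∑ t ∈ Finset.range (wl S h + 1), (Pop T μ ^ N) (Hf t) 1 ≤
      C * Real.exp (κ₀ * c) * (1 - r)⁻¹ := by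
    refine (Finset.sum_le_sum fun t _ => h4 t).trans ?_
    rw [← Finset.mul_sum]
    apply mul_le_mul_of_nonneg_left _ (by positivity)
    rw [← tsum_geometric_of_lt_one hr0 hr1]
    exact (summable_geometric_of_lt_one hr0 hr1).sum_le_tsum _ (fun i _ => pow_nonneg hr0 i)
  linarith

/-- exponential Lyapunov function -/
noncomputable def phi (S : Set Γ) (κ : ℝ) (q g : Γ) : ℝ := Real.exp (-κ * wdist S g q)

lemma Setup.lyap (H : Setup S δ T μ B ν) : ∃ C κ ρ : ℝ, 1 ≤ C ∧ 0 < κ ∧ 0 < ρ ∧ ρ < 1 ∧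
    (∀ t, aa B ν t ≤ C * Real.exp (-κ * t)) ∧
    ∀ n q g, (Pop T μ ^ n) (phi S κ q) g ≤ C * ρ ^ n * phi S κ q g := by
  obtain ⟨C1, κ₀, hC1, hκ0, hexp⟩ := H.aa_exp
  obtain ⟨C2, hC2, hmean⟩ := H.gp_mean
  obtain ⟨N, hN⟩ := H.drift ⌈2 * C2 + 1⌉₊
  have hN' : 2 * C2 + 1 ≤ (Pop T μ ^ N) (fun g => (wl S g : ℝ)) 1 := (Nat.le_ceil _).trans hN
  have hNpos : 0 < N := by
    rcases Nat.eq_zero_or_pos N with h | h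
    · rw [h] at hN'; simp [wl_one] at hN'; linarith
    · exact h
  have hNR : (1:ℝ) ≤ N := by exact_mod_cast hNpos
  set κ := min κ₀ (1 / (2 * (N:ℝ) ^ 2)) with hκ
  have hκpos : 0 < κ := lt_min hκ0 (by positivity)
  have hκN : κ * (N:ℝ) ^ 2 ≤ 1 / 2 := by
    have : κ ≤ 1 / (2 * (N:ℝ) ^ 2) := min_le_right _ _
    rw [le_div_iff₀ (by positivity)] at this
    linarith
  have hκ2 : κ ≤ 1 / 2 := by
    have h1 : (1:ℝ) ≤ (N:ℝ) ^ 2 := one_le_pow₀ hNR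
    have h2 := mul_le_mul_of_nonneg_left h1 hκpos.le
    linarith
  have hκN1 : κ * N ≤ 1 := by nlinarith
  -- drift of the Lyapunov function
  have hstep1 : ∀ h, (Pop T μ ^ N) (phi S κ h) 1 ≤ (1 - κ / 2) * phi S κ h 1 := by
    intro h
    have h1 := Pop_local H.hT H.hS N 1 (phi S κ h)
      (phi S κ h 1 • ((fun _ => 1 + κ ^ 2 * N ^ 2) - κ • (fun g => (wl S g : ℝ))
        + (2 * κ) • (fun g => gp S 1 g h))) (by
        intro y hy
        rw [wdist_one] at hy
        have hy' : (wl S y : ℝ) ≤ N := by exact_mod_cast hy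
        have hgp : gp S 1 y h = ((wl S y : ℝ) + wl S h - wdist S y h) / 2 := by
          unfold gp; rw [wdist_comm H.hS y 1, wdist_comm H.hS h 1, wdist_one, wdist_one]
        have hZ1 : (wdist S y h : ℝ) - wl S h ≤ wl S y := by
          have := gp_nonneg H.hS 1 y h; linarith
        have hZ2 : -(wl S y : ℝ) ≤ (wdist S y h : ℝ) - wl S h := by
          have := gp_le_left H.hS 1 y h
          rw [wdist_comm H.hS y 1, wdist_one] at this; linarith
        set Z := (wdist S y h : ℝ) - wl S h with hZ
        have hZa : |Z| ≤ N := abs_le.2 ⟨by linarith, by linarith⟩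
        have hx : |-κ * Z| ≤ 1 := by
          rw [abs_mul, abs_neg, abs_of_pos hκpos]
          nlinarith [abs_nonneg Z]
        have he := (abs_le.1 (Real.abs_exp_sub_one_sub_id_le hx)).2
        have hZ2' : Z ^ 2 ≤ (N:ℝ) ^ 2 := by
          rw [← sq_abs]; exact pow_le_pow_left₀ (abs_nonneg _) hZa 2
        have hphi : phi S κ h y = phi S κ h 1 * Real.exp (-κ * Z) := by
          unfold phi
          rw [← Real.exp_add, wdist_one, hZ]; ring_nf
        rw [hphi]
        simp only [Pi.smul_apply, Pi.sub_apply, Pi.add_apply, smul_eq_mul]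
        apply mul_le_mul_of_nonneg_left _ (Real.exp_pos _).le
        have h7 : κ ^ 2 * Z ^ 2 ≤ κ ^ 2 * (N:ℝ) ^ 2 := mul_le_mul_of_nonneg_left hZ2' (by positivity)
        rw [hgp]
        nlinarith)
    refine h1.trans ?_
    rw [map_smul, map_add, map_sub, map_smul, map_smul]
    simp only [Pi.smul_apply, Pi.sub_apply, Pi.add_apply, smul_eq_mul, Pop_const H.hT]
    rw [mul_comm]
    apply mul_le_mul_of_nonneg_right _ (Real.exp_pos _).le
    have h2 := hmean N h
    have h3 : κ ^ 2 * (N:ℝ) ^ 2 ≤ κ / 2 := by nlinarith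
    nlinarith
  have hstep : ∀ q g, (Pop T μ ^ N) (phi S κ q) g ≤ (1 - κ / 2) * phi S κ q g := by
    intro q g
    have h1 := hstep1 (g⁻¹ * q)
    have h2 := Pop_trans (T := T) (μ := μ) N (phi S κ q) g 1
    rw [mul_one] at h2
    rw [← h2]
    have h3 : (fun y => phi S κ q (g * y)) = phi S κ (g⁻¹ * q) := by
      funext y
      unfold phi
      rw [← wdist_left S g y, mul_inv_cancel_left]
    have h4 : phi S κ q g = phi S κ (g⁻¹ * q) 1 := by rw [← h3]; simp only [mul_one]
    rw [h3, h4]; exact h1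
  set ρ := 1 - κ / 2 / N with hρ
  have hkN : κ / 2 / N ≤ 1 / 4 := by
    rw [div_le_iff₀ (by linarith)]; linarith
  have hkN0 : 0 < κ / 2 / N := by positivity
  have hρ0 : 0 < ρ := by linarith
  have hρ1 : ρ < 1 := by linarith
  have hρN : 1 - κ / 2 ≤ ρ ^ N := by
    have := one_add_mul_le_pow (a := -(κ / 2 / N)) (by linarith) N
    have h2 : (N:ℝ) * -(κ / 2 / N) = - (κ / 2) := by field_simp
    rw [h2] at this
    rw [hρ]
    simpa [sub_eq_add_neg] using this
  set C3 := Real.exp (κ * N) / ρ ^ N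
  have hC3 : 0 ≤ C3 := by positivity
  have hly : ∀ n q g, (Pop T μ ^ n) (phi S κ q) g ≤ C3 * ρ ^ n * phi S κ q g := by
    intro n
    induction n using Nat.strong_induction_on with
    | _ n ih =>
      intro q g
      rcases lt_or_ge n N with hn | hn
      · have h1 := Pop_local H.hT H.hS n g (phi S κ q) (fun _ => Real.exp (κ * N) * phi S κ q g) (by
          intro y hy
          unfold phi
          rw [← Real.exp_add]
          apply Real.exp_le_exp.2
          have h2 := wdist_tri H.hS g y q
          have h3 : (wdist S g q : ℝ) ≤ N + wdist S y q := by
            have : wdist S g q ≤ N + wdist S y q := by omega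
            exact_mod_cast this
          nlinarith)
        rw [Pop_const H.hT] at h1
        refine h1.trans ?_
        apply mul_le_mul_of_nonneg_right _ (Real.exp_pos _).le
        have h5 : ρ ^ N ≤ ρ ^ n := pow_le_pow_of_le_one hρ0.le hρ1.le hn.le
        have h6 : Real.exp (κ * N) = C3 * ρ ^ N := by simp only [C3]; field_simp
        rw [h6]
        exact mul_le_mul_of_nonneg_left h5 hC3
      · obtain ⟨k, rfl⟩ := Nat.exists_eq_add_of_le' hn
        have h1 := Pop_mono H.hT k (f := (Pop T μ ^ N) (phi S κ q)) (h := ρ ^ N • phi S κ q) (by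
          intro y
          refine (hstep q y).trans ?_
          exact mul_le_mul_of_nonneg_right hρN (Real.exp_pos _).le) g
        rw [Pop_pow_add]
        refine h1.trans ?_
        rw [map_smul, Pi.smul_apply, smul_eq_mul]
        have h2 := ih k (by omega) q g
        rw [pow_add]
        have h3 := mul_le_mul_of_nonneg_left h2 (pow_nonneg hρ0.le N)
        linarith
  refine ⟨max C1 C3, κ, ρ, hC1.trans (le_max_left _ _), hκpos, hρ0, hρ1, fun t => ?_, fun n q g => ?_⟩
  · refine (hexp κ hκpos (min_le_left _ _) t).trans ?_
    exact mul_le_mul_of_nonneg_right (le_max_left _ _) (Real.exp_pos _).le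
  · refine (hly n q g).trans ?_
    have : 0 < phi S κ q g := Real.exp_pos _
    have : 0 < ρ ^ n := by positivity
    gcongr
    exact le_max_right _ _

end
end

section

/-! ### Green function -/

/-- Green function in terms of `pn`. -/
noncomputable def gr (T : Finset Γ) (μ : Γ → ℝ) (x y : Γ) : ℝ := ∑' n, pn T μ n x y

/-- Quantitative data extracted from the Lyapunov function. -/
structure Data (S : Set Γ) (T : Finset Γ) (μ : Γ → ℝ) (C κ ρ ε : ℝ) : Prop where
  C1 : 1 ≤ C
  κ0 : 0 < κ
  ρ0 : 0 < ρ
  ρ1 : ρ < 1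
  ε0 : 0 < ε
  ε1 : ε ≤ 1
  lyap : ∀ n q g, (Pop T μ ^ n) (phi S κ q) g ≤ C * ρ ^ n * phi S κ q g
  low : ∀ x y, ∃ m, ε ^ (wdist S x y) ≤ pn T μ m x y

section
variable {S : Set Γ} {δ : ℝ} {T : Finset Γ} {μ : Γ → ℝ} {C κ ρ ε : ℝ}

lemma green_eq (hT : Carrier S T μ) (x y : Γ) : green μ x y = gr T μ x y := by
  unfold green gr
  simp only [ptrans_eq hT]

lemma dl_le_phi (κ : ℝ) (y z : Γ) : dl y z ≤ phi S κ y z := by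
  by_cases h : z = y
  · subst h; simp [dl_self, phi, wdist_self]
  · rw [dl_ne h]; exact (Real.exp_pos _).le

lemma Data.pn_le (D : Data S T μ C κ ρ ε) (hT : Carrier S T μ) (n : ℕ) (x y : Γ) :
    pn T μ n x y ≤ C * phi S κ y x * ρ ^ n := by
  have h1 := Pop_mono hT n (f := dl y) (h := phi S κ y) (dl_le_phi κ y) x
  have h2 := D.lyap n y x
  unfold pn
  linarith

lemma Data.summ (D : Data S T μ C κ ρ ε) (hT : Carrier S T μ) (x y : Γ) :
    Summable fun n => pn T μ n x y :=
  Summable.of_nonneg_of_le (fun n => pn_nonneg hT n x y) (fun n => D.pn_le hT n x y)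
    ((summable_geometric_of_lt_one D.ρ0.le D.ρ1).mul_left _)

lemma gr_nonneg (hT : Carrier S T μ) (x y : Γ) : 0 ≤ gr T μ x y :=
  tsum_nonneg fun n => pn_nonneg hT n x y

lemma Data.gr_le (D : Data S T μ C κ ρ ε) (hT : Carrier S T μ) (x y : Γ) :
    gr T μ x y ≤ C * (1 - ρ)⁻¹ * phi S κ y x := by
  have h := (D.summ hT x y).tsum_le_tsum (fun n => D.pn_le hT n x y)
    ((summable_geometric_of_lt_one D.ρ0.le D.ρ1).mul_left _)
  rw [tsum_mul_left, tsum_geometric_of_lt_one D.ρ0.le D.ρ1] at h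
  unfold gr
  linarith

lemma Data.pn_le_gr (D : Data S T μ C κ ρ ε) (hT : Carrier S T μ) (m : ℕ) (x y : Γ) :
    pn T μ m x y ≤ gr T μ x y :=
  (D.summ hT x y).le_tsum m (fun n _ => pn_nonneg hT n x y)

lemma Data.gr_low (D : Data S T μ C κ ρ ε) (hT : Carrier S T μ) (x y : Γ) :
    ε ^ (wdist S x y) ≤ gr T μ x y := by
  obtain ⟨m, hm⟩ := D.low x y
  exact hm.trans (D.pn_le_gr hT m x y)

lemma Data.gr_pos (D : Data S T μ C κ ρ ε) (hT : Carrier S T μ) (x y : Γ) : 0 < gr T μ x y :=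
  (pow_pos D.ε0 _).trans_le (D.gr_low hT x y)

lemma gr_trans (k x y : Γ) : gr T μ (k * x) (k * y) = gr T μ x y := by
  unfold gr; simp only [pn_trans]

lemma gr_diag (y : Γ) : gr T μ y y = gr T μ 1 1 := by
  have := gr_trans (T := T) (μ := μ) y 1 1
  rwa [mul_one] at this

lemma Data.gr_mul (D : Data S T μ C κ ρ ε) (hT : Carrier S T μ) (x y z : Γ) :
    ε ^ (wdist S y z) * gr T μ x y ≤ gr T μ x z := by
  obtain ⟨m, hm⟩ := D.low y z
  have h1 : gr T μ x y * pn T μ m y z ≤ gr T μ x z := by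
    unfold gr
    rw [← tsum_mul_right]
    have hs := (D.summ hT x z)
    refine (((D.summ hT x y).mul_right _).tsum_le_tsum (fun n => pn_add hT n m x y z)
      ((summable_nat_add_iff m).2 hs)).trans ?_
    rw [← hs.sum_add_tsum_nat_add m]
    have : 0 ≤ ∑ i ∈ Finset.range m, pn T μ i x z := Finset.sum_nonneg fun i _ => pn_nonneg hT i x z
    linarith
  have h2 := gr_nonneg hT x y
  nlinarith

lemma Data.gr_Pop (D : Data S T μ C κ ρ ε) (hT : Carrier S T μ) (p g : Γ) :
    Pop T μ (fun x => gr T μ x p) g = gr T μ g p - dl p g := by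
  rw [Pop_apply]
  unfold gr
  rw [(D.summ hT g p).tsum_eq_zero_add]
  simp only [← tsum_mul_left]
  rw [← Summable.tsum_finsetSum (fun s _ => (D.summ hT (g * s) p).mul_left _)]
  have : ∀ n, pn T μ (n + 1) g p = ∑ s ∈ T, μ s * pn T μ n (g * s) p := by
    intro n
    unfold pn
    rw [Pop_pow_succ', Pop_apply]
  simp only [this]
  simp [pn]

lemma Setup.data {B : Boundary Γ S} [mB : MeasurableSpace B.pt] {ν : Measure B.pt}
    (H : Setup S δ T μ B ν) : ∃ C κ ρ ε : ℝ, Data S T μ C κ ρ ε ∧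
      ∀ t, aa B ν t ≤ C * Real.exp (-κ * t) := by
  obtain ⟨C, κ, ρ, h1, h2, h3, h4, h5, h6⟩ := H.lyap
  obtain ⟨ε, e1, e2, e3⟩ := pn_lower H.hS H.hμ H.hT
  exact ⟨C, κ, ρ, ε, ⟨h1, h2, h3, h4, e1, e2, h6, e3⟩, h5⟩

end
end

section

/-! ### Lower bound -/
section
variable {S : Set Γ} {δ : ℝ} {T : Finset Γ} {μ : Γ → ℝ} {B : Boundary Γ S}
    [mB : MeasurableSpace B.pt] {ν : Measure B.pt} {C κ ρ ε : ℝ}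

lemma Tset_sub_Uset (hS : IsGenSet S) (hδ : IsHyperbolic S δ) {x : ℕ → Γ} {ξ : B.pt}
    (hx : RayTo B x ξ) (m : ℕ) (s R : ℝ) (hs : R + 2 * δ < s) (hm : s ≤ m) :
    Tset B 1 (x m) s ⊆ Uset B ξ R := by
  intro η hη x' y' hx' hy'
  have h0 := hδ.1
  obtain ⟨N1, h1⟩ := Tset_all hS hδ hη ⟨hy'.2.1, hy'.2.2⟩
  obtain ⟨N2, h2⟩ := (equivSeq_iff x' x).1 (rep_equiv ⟨hx'.2.1, hx'.2.2⟩ ⟨hx.2.1, hx.2.2⟩) s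
  set n := max m (max N1 N2)
  have hn0 : m ≤ n := le_max_left _ _
  have hn1 : N1 ≤ n := (le_max_left _ _).trans (le_max_right _ _)
  have hn2 : N2 ≤ n := (le_max_right _ _).trans (le_max_right _ _)
  refine ⟨n, ?_⟩
  have e1 := h1 n hn1
  have e2 := h2 n hn2 n hn2
  have e3 := ray_gp hx.1 hn0
  rw [gp_comm hS] at e3
  have e4 := hyp_ge hS hδ 1 (x' n) (x n) (x m) s e2 (by linarith)
  have e5 := hyp_ge hS hδ 1 (x' n) (x m) (y' n) (s - δ) e4 e1
  linarith

lemma Data.phi_fin (D : Data S T μ C κ ρ ε) (hS : IsGenSet S) (p : Γ) (K e : ℝ) (hK : 0 ≤ K) (he : 0 < e) :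
    {g | e < K * phi S κ p g}.Finite := by
  apply (wdist_ball_finite hS p ⌈K / e / κ⌉₊).subset
  intro g hg
  have hg' : e < K * phi S κ p g := hg
  show wdist S p g ≤ _
  by_contra h
  push Not at h
  have h1 : K / e / κ < wdist S p g := (Nat.le_ceil _).trans_lt (by exact_mod_cast h)
  rw [div_lt_iff₀ D.κ0, div_lt_iff₀ he] at h1
  have h2 : (wdist S p g) * κ + 1 ≤ Real.exp (κ * wdist S p g) := by
    have := Real.add_one_le_exp (κ * wdist S p g); linarith
  have h3 : phi S κ p g * Real.exp (κ * wdist S p g) = 1 := by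
    unfold phi; rw [← Real.exp_add, wdist_comm hS g p]; simp
  have h4 : e * Real.exp (κ * wdist S p g) < K := by
    have := mul_lt_mul_of_pos_right hg' (Real.exp_pos (κ * wdist S p g))
    rw [mul_assoc, h3] at this; linarith
  have h5 := mul_le_mul_of_nonneg_left h2 he.le
  nlinarith

lemma Setup.lower (H : Setup S δ T μ B ν) (D : Data S T μ C κ ρ ε) : ∃ K : ℝ, 0 < K ∧
    ∀ (ξ : B.pt) (x : ℕ → Γ), RayTo B x ξ → ∀ R : ℕ,
      K * gr T μ 1 (x R) ≤ (ν (Uset B ξ R)).toReal := by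
  obtain ⟨c, hc0, hc, hhalf⟩ := H.W_half
  have h0 := H.hδ.1
  set k := ⌈c + 2 * δ⌉₊ + 1 with hk
  have hk' : c + 2 * δ < k := by
    have := Nat.le_ceil (c + 2 * δ)
    rw [hk]; push_cast; linarith
  have hG := D.gr_pos H.hT (1 : Γ) 1
  set a := 1 / 2 / gr T μ (1 : Γ) 1 with ha
  have ha0 : 0 < a := by positivity
  refine ⟨a * ε ^ k, mul_pos ha0 (pow_pos D.ε0 _), fun ξ x hx R => ?_⟩
  set m := R + k with hm
  set p := x m with hp
  have hwl : wl S p = m := by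
    have := hx.1.2 0 m
    rw [hx.1.1, wdist_one] at this
    simpa [Nat.dist] using this
  have hmR : (m : ℝ) = R + k := by rw [hm]; push_cast; ring
  set A := Wset B p (m - c) with hA
  have hAU : A ⊆ Uset B ξ R := (Wset_sub B _ _).trans
    (Tset_sub_Uset H.hS H.hδ hx m _ R (by linarith) (by linarith))
  have hp1 : (1 : Γ) ≠ p := by
    intro h
    rw [← h, wl_one] at hwl
    omega
  have hmin := min_principle H.hμ H.hT {p}ᶜ (by
      intro h
      have : p ∈ ({p}ᶜ : Set Γ) := by rw [h]; trivial
      exact this rfl) (hf B ν A - a • fun g => gr T μ g p) (by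
      intro g hg
      rw [map_sub, map_smul, H.hf_harm (H.Wset_meas _ _)]
      simp only [Pi.sub_apply, Pi.smul_apply, smul_eq_mul]
      rw [D.gr_Pop H.hT, dl_ne (by simpa using hg), sub_zero]) (by
      intro g hg s hs hgs
      have : g * s = p := by simpa using hgs
      rw [this]
      simp only [Pi.sub_apply, Pi.smul_apply, smul_eq_mul]
      have h1 := hhalf p p m (by rw [gp_self, wdist_comm H.hS, wdist_one, hwl])
      rw [gr_diag, ha, div_mul_cancel₀ _ hG.ne']
      linarith) (by
      intro e he
      have hρ : 0 < 1 - ρ := by have := D.ρ1; linarith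
      have hC : 0 < C := by have := D.C1; linarith
      apply (D.phi_fin H.hS p (a * (C * (1 - ρ)⁻¹)) e (by positivity) he).subset
      rintro g ⟨-, hw⟩
      simp only [Pi.sub_apply, Pi.smul_apply, smul_eq_mul] at hw
      have h1 := hf_nonneg (ν := ν) A g
      have h2 := mul_le_mul_of_nonneg_left (D.gr_le H.hT g p) ha0.le
      show e < _
      linarith) 1 (by simpa using hp1)
  simp only [Pi.sub_apply, Pi.smul_apply, smul_eq_mul, hf_one] at hmin
  have h3 := H.mono (ν := ν) hAU
  have h4 := D.gr_mul H.hT 1 (x R) p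
  have h5 : wdist S (x R) p = k := by
    rw [hp, hx.1.2, hm]; simp [Nat.dist]
  rw [h5] at h4
  have h6 := mul_le_mul_of_nonneg_left h4 ha0.le
  linarith

end

/-! ### Upper bound: tools -/

lemma dbl (ρ E : ℝ) (hρ0 : 0 < ρ) (hρ1 : ρ < 1) (hE : 1 ≤ E) (a : ℕ) (ha : 0 < a) :
    ∃ M : ℝ, 0 ≤ M ∧ ∀ k : ℕ, ρ ^ (2 ^ (k / a)) * E ^ k ≤ M * (1 / 2) ^ k := by
  set b := (2 * E) ^ a with hb
  have hb1 : 1 ≤ b := one_le_pow₀ (by linarith)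
  obtain ⟨c, hc⟩ := pow_unbounded_of_one_lt b (one_lt_two)
  have hlim := tendsto_pow_const_mul_const_pow_of_abs_lt_one c (r := ρ)
    (by rw [abs_of_pos hρ0]; exact hρ1)
  obtain ⟨M, hM⟩ := hlim.bddAbove_range
  have hM' : ∀ n : ℕ, (n:ℝ) ^ c * ρ ^ n ≤ M := fun n => hM ⟨n, rfl⟩
  have hM0 : 0 ≤ M := le_trans (by positivity) (hM' 0)
  refine ⟨b * M, by positivity, fun k => ?_⟩
  set m := k / a with hm
  have hk : k ≤ a * (m + 1) := by
    have := Nat.lt_div_mul_add (a := k) ha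
    rw [← hm] at this
    nlinarith
  have h1 : (2 * E) ^ k ≤ b * b ^ m := by
    refine (pow_le_pow_right₀ (by linarith) hk).trans (le_of_eq ?_)
    rw [pow_mul, pow_succ, mul_comm]
  have h2 : b ^ m ≤ ((2 ^ m : ℕ) : ℝ) ^ c := by
    refine (pow_le_pow_left₀ (by linarith) hc.le m).trans (le_of_eq ?_)
    push_cast
    rw [← pow_mul, ← pow_mul, mul_comm]
  have h3 := hM' (2 ^ m)
  have h4 : ρ ^ (2 ^ m) * (2 * E) ^ k ≤ b * M := by
    have hp : 0 < ρ ^ (2 ^ m) := by positivity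
    calc ρ ^ (2 ^ m) * (2 * E) ^ k ≤ ρ ^ (2 ^ m) * (b * ((2 ^ m : ℕ) : ℝ) ^ c) := by gcongr; exact h1.trans (by gcongr)
      _ = b * (((2 ^ m : ℕ) : ℝ) ^ c * ρ ^ (2 ^ m)) := by ring
      _ ≤ b * M := by gcongr
  have h5 : E ^ k = (2 * E) ^ k * (1 / 2) ^ k := by rw [← mul_pow]; congr 1; ring
  rw [h5, ← mul_assoc]
  gcongr

section
variable {S : Set Γ} {δ : ℝ} {T : Finset Γ} {μ : Γ → ℝ}

/-- Existence of a path of length `n` from `g` to `y` avoiding `Z`. -/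
def Av (T : Finset Γ) (Z : Set Γ) : ℕ → Γ → Γ → Prop
  | 0 => fun g y => g = y ∧ g ∉ Z
  | n + 1 => fun g y => g ∉ Z ∧ ∃ s ∈ T, Av T Z n (g * s) y

lemma Av_split (Z : Set Γ) (a b : ℕ) (g y : Γ) (h : Av T Z (a + b) g y) :
    ∃ z, Av T Z a g z ∧ Av T Z b z y := by
  induction a generalizing g with
  | zero =>
    rw [zero_add] at h
    refine ⟨g, ⟨rfl, ?_⟩, h⟩
    cases b with
    | zero => exact h.2
    | succ b => exact h.1
  | succ a ih =>
    have : a + 1 + b = (a + b) + 1 := by ring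
    rw [this] at h
    obtain ⟨h1, s, hs, h2⟩ := h
    obtain ⟨z, hz1, hz2⟩ := ih _ h2
    exact ⟨z, ⟨h1, s, hs, hz1⟩, hz2⟩

lemma Av_gp (hS : IsGenSet S) (hδ : IsHyperbolic S δ) (hT : Carrier S T μ) (q : Γ) (r : ℕ)
    (m : ℕ) (g y : Γ) (h : Av T {z | wdist S z q ≤ r} (2 ^ m) g y) :
    (r : ℝ) - 1 / 2 - m * δ ≤ gp S q g y := by
  induction m generalizing g y with
  | zero =>
    obtain ⟨h1, s, hs, rfl, h2⟩ := h
    have h1' : r < wdist S g q := not_le.1 h1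
    have h2' : r < wdist S (g * s) q := not_le.1 h2
    have h3 := wdist_mul_gen (hT.sub s hs) g
    unfold gp
    have e1 : (r : ℝ) < wdist S g q := by exact_mod_cast h1'
    have e2 : (r : ℝ) < wdist S (g * s) q := by exact_mod_cast h2'
    have e3 : (wdist S g (g * s) : ℝ) ≤ 1 := by exact_mod_cast h3
    push_cast
    linarith
  | succ m ih =>
    rw [pow_succ, mul_two] at h
    obtain ⟨z, hz1, hz2⟩ := Av_split _ _ _ _ _ h
    have := hyp_ge hS hδ q g z y _ (ih _ _ hz1) (ih _ _ hz2)
    push_cast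
    linarith

lemma Av_sub (hT : Carrier S T μ) (Z : Set Γ) (f F : Γ → ℝ) (hF : ∀ y, 0 ≤ F y)
    (hZ : ∀ y ∈ Z, f y = 0) (hsub : ∀ y, f y ≤ Pop T μ f y) (n : ℕ) (g : Γ)
    (hA : ∀ y, Av T Z n g y → f y ≤ F y) : f g ≤ (Pop T μ ^ n) F g := by
  induction n generalizing g with
  | zero =>
    by_cases hg : g ∈ Z
    · rw [hZ g hg]; exact Pop_nonneg hT 0 hF g
    · simpa using hA g ⟨rfl, hg⟩
  | succ n ih =>
    by_cases hg : g ∈ Z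
    · rw [hZ g hg]; exact Pop_nonneg hT _ hF g
    · refine (hsub g).trans ?_
      rw [Pop_pow_succ', Pop_apply, Pop_apply]
      refine Finset.sum_le_sum fun s hs => mul_le_mul_of_nonneg_left ?_ (hT.nonneg s)
      exact ih _ fun y hy => hA y ⟨hg, s, hs, hy⟩

end
end

section

/-! ### Upper bound -/
section
variable {S : Set Γ} {δ : ℝ} {T : Finset Γ} {μ : Γ → ℝ} {B : Boundary Γ S}
    [mB : MeasurableSpace B.pt] {ν : Measure B.pt} {C κ ρ ε : ℝ}

lemma Uset_sub (hS : IsGenSet S) (hδ : IsHyperbolic S δ) {x : ℕ → Γ} {ξ : B.pt}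
    (hx : RayTo B x ξ) (R : ℕ) : Uset B ξ R ⊆ Tset B 1 (x R) (R - 2 * δ) := by
  intro η hη
  have h0 := hδ.1
  obtain ⟨y, hy⟩ := exists_ray hS hδ B η
  obtain ⟨n, hn⟩ := hη x y hx hy
  have hwl : wdist S (x n) 1 = n := by
    have := hx.1.2 n 0
    rw [hx.1.1] at this
    simpa [Nat.dist] using this
  have hRn : (R : ℝ) < n := by
    have := gp_le_left hS 1 (x n) (y n)
    rw [hwl] at this
    linarith
  have hRn' : R ≤ n := by exact_mod_cast hRn.le
  refine ⟨y, ⟨hy.2.1, hy.2.2⟩, n, fun k hk => ?_⟩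
  have e1 := ray_gp hx.1 hRn'
  have e2 := ray_gp hy.1 hk
  have e3 := hyp_ge hS hδ 1 (x R) (x n) (y n) R e1.ge hn.le
  have e4 := hyp_ge hS hδ 1 (x R) (y n) (y k) (R - δ) e3 (by linarith)
  linarith

lemma ray_dist {x : ℕ → Γ} (hx : IsGeodesicRay S x) {m n : ℕ} (h : m ≤ n) :
    wdist S (x m) (x n) = n - m := by
  rw [hx.2]; simp [Nat.dist, h]

/-- geometry: `y` on the far side of `q` from the shadow of `p`. -/
lemma far_side (hS : IsGenSet S) (hδ : IsHyperbolic S δ) (B : Boundary Γ S) {x : ℕ → Γ}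
    (hx : IsGeodesicRay S x)
    (R j : ℕ) (hjR : j ≤ R) (hj : 8 * δ < j) (y : Γ) (hy : gp S (x (R - j)) y (x R) ≤ 2 * δ) :
    Tset B 1 (x R) (R - 4 * δ) ⊆ Tset B y (x R) (wdist S y (x (R - j)) - 10 * δ) := by
  have h0 := hδ.1
  rintro η ⟨u, hu, N, hN⟩
  refine ⟨u, hu, N, fun n hn => ?_⟩
  have h1 := hN n hn
  set p := x R
  set q := x (R - j)
  have d1 : wdist S p 1 = R := by
    rw [wdist_comm hS, ← hx.1, ray_dist hx (Nat.zero_le R)]; simp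
  have d2 : wdist S q p = j := by
    rw [ray_dist hx (Nat.sub_le R j)]; omega
  have d2' : wdist S p q = j := by rw [wdist_comm hS, d2]
  have d3 : wdist S 1 q = R - j := by
    rw [← hx.1, ray_dist hx (Nat.zero_le _)]; simp
  have e1 : gp S p 1 (u n) ≤ 4 * δ := by
    rw [gp_swap hS p 1, d1]; linarith
  have e2 : gp S p 1 q = j := by
    unfold gp
    rw [wdist_comm hS 1 p, d1, d2, d3]
    push_cast [hjR]; ring
  have e3 : gp S p q (u n) ≤ 5 * δ := by
    by_contra h
    push Not at h
    have h6 : 5 * δ < min (j : ℝ) (gp S p q (u n)) := lt_min (by linarith) h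
    have h5 := hyp_ge hS hδ p 1 q (u n) (min (j : ℝ) (gp S p q (u n)))
      (by rw [e2]; exact min_le_left _ _) (min_le_right _ _)
    linarith
  have e4 : (j : ℝ) - 5 * δ ≤ gp S q p (u n) := by
    rw [gp_swap hS q p, d2]; linarith
  have e5 : gp S q (u n) y ≤ 3 * δ := by
    by_contra h
    push Not at h
    have h6 : 3 * δ < min (gp S q (u n) y) (gp S q p (u n)) := lt_min h (by linarith)
    have h5 := hyp_ge hS hδ q p (u n) y _ (min_le_right (gp S q (u n) y) (gp S q p (u n)))
      (min_le_left _ _)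
    rw [gp_comm hS q p y] at h5
    linarith
  rw [gp_change hS y q, gp_comm hS q p y]
  linarith

lemma Setup.upper_step (H : Setup S δ T μ B ν) (D : Data S T μ C κ ρ ε)
    (ha : ∀ t, aa B ν t ≤ C * Real.exp (-κ * t)) {x : ℕ → Γ}
    (hx : IsGeodesicRay S x) (R j k m r r' : ℕ) (hjk : j ≤ k) (hkR : k ≤ R) (hj : 8 * δ < j)
    (hr : (r : ℝ) + δ < k - j) (hr' : 2 * δ + 1 / 2 + m * δ < r') (K : ℝ) (hK : 0 ≤ K)
    (hB : ∀ g, wdist S g (x (R - j)) ≤ r' → hf B ν (Wset B (x R) (R - 4 * δ)) g ≤ K * gr T μ g (x R))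
    (g : Γ) (hg : wdist S g (x (R - k)) ≤ r) :
    hf B ν (Wset B (x R) (R - 4 * δ)) g ≤ K * gr T μ g (x R) +
      C * Real.exp (10 * κ * δ) * C * ρ ^ (2 ^ m) := by
  have h0 := H.hδ.1
  set p := x R with hp
  set q := x (R - j) with hq
  set q' := x (R - k) with hq'
  set h := hf B ν (Wset B p (R - 4 * δ)) with hh
  set f : Γ → ℝ := fun y => max (h y - K * gr T μ y p) 0 with hfdef
  have hC : 0 < C := by have := D.C1; linarith
  have hf0 : ∀ y, 0 ≤ f y := fun y => le_max_right _ _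
  have hfh : ∀ y, f y ≤ h y := fun y => max_le (by
    have := mul_nonneg hK (gr_nonneg H.hT y p); linarith) (hf_nonneg _ _)
  have hgp : gp S q g p ≤ δ := by
    have d1 : wdist S q' q = k - j := by
      rw [hq, hq', ray_dist hx (by omega)]; omega
    have d2 : wdist S q p = j := by
      rw [hq, hp, ray_dist hx (Nat.sub_le R j)]; omega
    have d3 : wdist S q' p = k := by
      rw [hp, hq', ray_dist hx (Nat.sub_le R k)]; omega
    have e1 : gp S q q' p = 0 := by
      unfold gp
      rw [wdist_comm H.hS p q, d1, d2, d3]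
      push_cast [hjk]; ring
    have e2 : δ < gp S q q' g := by
      have t1 := wdist_tri H.hS q' g q
      have t1' : (wdist S q' q : ℝ) ≤ wdist S q' g + wdist S g q := by exact_mod_cast t1
      have t2 : (wdist S q' g : ℝ) ≤ r := by rw [wdist_comm H.hS]; exact_mod_cast hg
      have t3 : (wdist S q' q : ℝ) = k - j := by rw [d1]; push_cast [hjk]; ring
      unfold gp
      linarith
    by_contra hcon
    push Not at hcon
    have h6 : δ < min (gp S q q' g) (gp S q g p) := lt_min e2 hcon
    have h5 := hyp_ge H.hS H.hδ q q' g p _ (min_le_left (gp S q q' g) (gp S q g p)) (min_le_right _ _)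
    linarith
  have hmain := Av_sub H.hT {z | wdist S z q ≤ r'} f ((C * Real.exp (10 * κ * δ)) • phi S κ q)
    (fun y => by
      simp only [Pi.smul_apply, smul_eq_mul]
      have : 0 < phi S κ q y := Real.exp_pos _
      positivity)
    (fun y hy => by
      have := hB y hy
      simp only [hfdef]
      apply max_eq_right; linarith)
    (fun y => by
      have hP0 : 0 ≤ Pop T μ f y := by
        have := Pop_nonneg H.hT 1 hf0 y; rwa [pow_one] at this
      refine max_le ?_ hP0
      have h1 := Pop_mono H.hT 1 (f := h - K • fun z => gr T μ z p) (h := f)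
        (fun z => le_max_left _ _) y
      rw [pow_one, map_sub, map_smul, H.hf_harm (H.Wset_meas _ _)] at h1
      simp only [Pi.sub_apply, Pi.smul_apply, smul_eq_mul] at h1
      rw [D.gr_Pop H.hT] at h1
      have := mul_nonneg hK (dl_nonneg p y)
      linarith)
    (2 ^ m) g
    (fun y hy => by
      refine (hfh y).trans ?_
      have e1 := Av_gp H.hS H.hδ H.hT q r' m g y hy
      have e2 : gp S q y p ≤ 2 * δ := by
        by_contra hcon
        push Not at hcon
        have h6 : 2 * δ < min (gp S q g y) (gp S q y p) := lt_min (by linarith) hcon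
        have h5 := hyp_ge H.hS H.hδ q g y p _ (min_le_left (gp S q g y) (gp S q y p))
          (min_le_right _ _)
        linarith
      have e3 := H.hf_le_aa ((Wset_sub B p (R - 4 * δ)).trans
        (far_side H.hS H.hδ B hx R j (hjk.trans hkR) hj y e2))
      refine e3.trans ((ha _).trans (le_of_eq ?_))
      simp only [Pi.smul_apply, smul_eq_mul]
      unfold phi
      rw [mul_assoc, ← Real.exp_add]
      rw [hq]
      congr 2
      ring)
  rw [map_smul, Pi.smul_apply, smul_eq_mul] at hmain
  have h1 : h g - K * gr T μ g p ≤ f g := le_max_left _ _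
  have h2 := D.lyap (2 ^ m) q g
  have h3 : phi S κ q g ≤ 1 := by
    unfold phi
    rw [Real.exp_le_one_iff]
    have := D.κ0
    have : (0:ℝ) ≤ wdist S g q := by positivity
    nlinarith
  have hρ := D.ρ0
  have h4 : C * ρ ^ 2 ^ m * phi S κ q g ≤ C * ρ ^ 2 ^ m :=
    mul_le_of_le_one_right (by positivity) h3
  have h5 := mul_le_mul_of_nonneg_left (h2.trans h4)
    (show 0 ≤ C * Real.exp (10 * κ * δ) by positivity)
  linarith

lemma Setup.upper (H : Setup S δ T μ B ν) (D : Data S T μ C κ ρ ε)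
    (ha : ∀ t, aa B ν t ≤ C * Real.exp (-κ * t)) : ∃ K : ℝ, 0 < K ∧
    ∀ (ξ : B.pt) (x : ℕ → Γ), RayTo B x ξ → ∀ R : ℕ,
      (ν (Uset B ξ R)).toReal ≤ K * gr T μ 1 (x R) := by
  have h0 := H.hδ.1
  have hε := D.ε0
  set Δ := ⌈δ⌉₊ + 1 with hΔ
  have hΔδ : δ ≤ Δ := by
    have := Nat.le_ceil δ
    rw [hΔ]; push_cast; linarith
  have hΔ1 : (1:ℝ) ≤ Δ := by rw [hΔ]; push_cast; linarith [Nat.cast_nonneg (α := ℝ) ⌈δ⌉₊]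
  have hE : 1 ≤ (ε⁻¹) ^ 2 := one_le_pow₀ ((one_le_inv₀ hε).2 D.ε1)
  obtain ⟨M, hM0, hM⟩ := dbl ρ ((ε⁻¹) ^ 2) D.ρ0 D.ρ1 hE (16 * Δ) (by omega)
  set c1 := C * Real.exp (10 * κ * δ) * C with hc1
  have hC : 0 < C := by have := D.C1; linarith
  have hc1p : 0 < c1 := by positivity
  set Kb := ((ε⁻¹) ^ 2) ^ (100 * Δ) with hKb
  have hKb0 : 0 < Kb := by positivity
  set M' := c1 * M with hM'
  have hM'0 : 0 ≤ M' := by positivity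
  refine ⟨Kb + M' * 2, by linarith, fun ξ x hx R => ?_⟩
  set p := x R with hp
  set h := hf B ν (Wset B p (R - 4 * δ)) with hh
  have hglow : ∀ k ≤ R, ∀ g, wdist S g (x (R - k)) ≤ k / 4 → 1 ≤ ((ε⁻¹) ^ 2) ^ k * gr T μ g p := by
    intro k hk g hg
    have d3 : wdist S (x (R - k)) p = k := by
      rw [hp, ray_dist hx.1 (Nat.sub_le R k)]; omega
    have h1 := wdist_tri H.hS g (x (R - k)) p
    have h2 : wdist S g p ≤ 2 * k := by omega
    have h3 := D.gr_low H.hT g p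
    have h4 : ε ^ (2 * k) ≤ gr T μ g p := (pow_le_pow_of_le_one hε.le D.ε1 h2).trans h3
    rw [← pow_mul, inv_pow]
    rw [← div_eq_inv_mul, le_div_iff₀ (by positivity), one_mul]
    exact h4
  have claim : ∀ k : ℕ, k ≤ R → ∀ g, wdist S g (x (R - k)) ≤ k / 4 →
      h g ≤ (Kb + M' * (2 - (1 / 2) ^ k)) * gr T μ g p := by
    intro k
    induction k using Nat.strong_induction_on with
    | _ k ih =>
      intro hkR g hg
      have hlow := hglow k hkR g hg
      have hG0 := gr_nonneg H.hT g p
      have hhalf : (1 / 2 : ℝ) ^ k ≤ 1 := pow_le_one₀ (by norm_num) (by norm_num)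
      rcases lt_or_ge k (100 * Δ) with hk | hk
      · have h1 : ((ε⁻¹) ^ 2) ^ k ≤ Kb := pow_le_pow_right₀ hE hk.le
        have h2 : h g ≤ 1 := H.hf_le_one _ _
        have h3 := mul_le_mul_of_nonneg_right h1 hG0
        have h4 : 0 ≤ M' * (2 - (1 / 2) ^ k) * gr T μ g p :=
          mul_nonneg (mul_nonneg hM'0 (by linarith)) hG0
        linarith
      · have hkR' : (100 * Δ : ℝ) ≤ k := by exact_mod_cast hk
        have hj : (k : ℝ) ≤ 2 * (k / 2 : ℕ) + 1 := by exact_mod_cast (by omega : k ≤ 2 * (k / 2) + 1)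
        have hj' : 2 * ((k / 2 : ℕ) : ℝ) ≤ k := by exact_mod_cast (by omega : 2 * (k / 2) ≤ k)
        have hr : 4 * ((k / 4 : ℕ) : ℝ) ≤ k := by exact_mod_cast (by omega : 4 * (k / 4) ≤ k)
        have hr' : (k : ℝ) ≤ 8 * ((k / 2 / 4 : ℕ) : ℝ) + 7 := by
          exact_mod_cast (by omega : k ≤ 8 * (k / 2 / 4) + 7)
        have hm : ((k / (16 * Δ) : ℕ) : ℝ) * (16 * Δ) ≤ k := by
          exact_mod_cast Nat.div_mul_le_self k (16 * Δ)
        have hmδ : ((k / (16 * Δ) : ℕ) : ℝ) * δ ≤ k / 16 := by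
          have : ((k / (16 * Δ) : ℕ) : ℝ) * δ ≤ ((k / (16 * Δ) : ℕ) : ℝ) * Δ := by gcongr
          linarith
        have hjlt : k / 2 < k := by
          have : 0 < k := by
            have : (0:ℝ) < k := by linarith
            exact_mod_cast this
          omega
        have hpow : (1 / 2 : ℝ) ^ k * 2 ≤ (1 / 2) ^ (k / 2) := by
          have h1 : (1 / 2 : ℝ) ^ k ≤ (1 / 2) ^ (k / 2 + 1) :=
            pow_le_pow_of_le_one (by norm_num) (by norm_num) (by omega)
          rw [pow_succ] at h1
          linarith
        have hhalf' : (1 / 2 : ℝ) ^ (k / 2) ≤ 1 := pow_le_one₀ (by norm_num) (by norm_num)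
        have hstep := H.upper_step D ha hx.1 R (k / 2) k (k / (16 * Δ)) (k / 4) (k / 2 / 4)
          hjlt.le hkR (by linarith) (by linarith) (by linarith)
          (Kb + M' * (2 - (1 / 2) ^ (k / 2)))
          (by have := mul_nonneg hM'0 (show (0:ℝ) ≤ 2 - (1 / 2) ^ (k / 2) by linarith); linarith)
          (ih (k / 2) hjlt (by omega)) g hg
        have h5 : c1 * ρ ^ (2 ^ (k / (16 * Δ))) ≤ M' * (1 / 2) ^ k * gr T μ g p := by
          have hρ := D.ρ0
          have h6 := hM k
          calc c1 * ρ ^ (2 ^ (k / (16 * Δ)))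
              ≤ c1 * ρ ^ (2 ^ (k / (16 * Δ))) * (((ε⁻¹) ^ 2) ^ k * gr T μ g p) :=
                le_mul_of_one_le_right (by positivity) hlow
            _ = c1 * (ρ ^ (2 ^ (k / (16 * Δ))) * ((ε⁻¹) ^ 2) ^ k) * gr T μ g p := by ring
            _ ≤ c1 * (M * (1 / 2) ^ k) * gr T μ g p := by gcongr
            _ = M' * (1 / 2) ^ k * gr T μ g p := by rw [hM']; ring
        have h7 : M' * ((1 / 2 : ℝ) ^ k * 2) * gr T μ g p ≤ M' * (1 / 2) ^ (k / 2) * gr T μ g p := by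
          gcongr
        calc h g ≤ _ := hstep
          _ ≤ (Kb + M' * (2 - (1 / 2) ^ (k / 2))) * gr T μ g p + M' * (1 / 2) ^ k * gr T μ g p := by
              linarith
          _ ≤ _ := by linarith
  have h1 := claim R le_rfl 1 (by rw [Nat.sub_self, hx.1.1, wdist_self]; exact Nat.zero_le _)
  have hsub : Uset B ξ R ⊆ Wset B p (R - 4 * δ) := by
    refine (Uset_sub H.hS H.hδ hx R).trans ?_
    have : (R : ℝ) - 2 * δ = R - 4 * δ + 2 * δ := by ring
    rw [this]; exact Wset_sup H.hS H.hδ B p _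
  have h2 := H.mono (ν := ν) hsub
  rw [hh, hf_one] at h1
  have hG0 := gr_nonneg H.hT 1 p
  have h3 : (0:ℝ) ≤ M' * (1 / 2) ^ R * gr T μ 1 p := by positivity
  linarith

end
end

theorem harmonic_measure_gibbs
    (Γ : Type) [Group Γ] (S : Set Γ) (δ : ℝ)
    (hS : IsGenSet S) (hδ : IsHyperbolic S δ) (hne : Nonelementary Γ)
    (μ : Γ → ℝ) (hμ : IsRWMeasure S μ)
    (B : Boundary Γ S)
    [mB : MeasurableSpace B.pt] (hmB : mB = @borel B.pt (btop B))
    (ν : Measure B.pt) (hν : IsProbabilityMeasure ν)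
    (hstat : ∀ A : Set B.pt, MeasurableSet A →
      ν A = ∑' g : Γ, ENNReal.ofReal (μ g) * ν (B.smul g ⁻¹' A)) :
    ∃ D : ℝ, 1 ≤ D ∧ ∀ (ξ : B.pt) (x : ℕ → Γ), RayTo B x ξ → ∀ R : ℕ,
      1 / D ≤ (ν (Uset B ξ R)).toReal / greenF μ 1 (x R) ∧
      (ν (Uset B ξ R)).toReal / greenF μ 1 (x R) ≤ D := by
  have H : Setup S δ hS.1.toFinset μ B ν :=
    ⟨hS, hδ, hne, hμ, exists_carrier hS hμ, hmB, hν, hstat⟩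
  obtain ⟨C, κ, ρ, ε, D, ha⟩ := H.data
  obtain ⟨K1, hK1, h1⟩ := H.lower D
  obtain ⟨K2, hK2, h2⟩ := H.upper D ha
  have hG : 0 < gr hS.1.toFinset μ 1 1 := D.gr_pos H.hT 1 1
  refine ⟨max 1 (max (K2 * gr hS.1.toFinset μ 1 1) (1 / (K1 * gr hS.1.toFinset μ 1 1))),
    le_max_left _ _, fun ξ x hx R => ?_⟩
  have e1 := h1 ξ x hx R
  have e2 := h2 ξ x hx R
  have hg : 0 < gr hS.1.toFinset μ 1 (x R) := D.gr_pos H.hT 1 (x R)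
  have hF : greenF μ 1 (x R) = gr hS.1.toFinset μ 1 (x R) / gr hS.1.toFinset μ 1 1 := by
    unfold greenF
    rw [green_eq H.hT, green_eq H.hT, gr_diag]
  rw [hF]
  generalize gr hS.1.toFinset μ 1 (x R) = g at *
  generalize gr hS.1.toFinset μ 1 1 = G at *
  have hgG : 0 < g / G := by positivity
  have hgg : g / G * G = g := by field_simp
  constructor
  · have h3 : 1 / (K1 * G) ≤ max 1 (max (K2 * G) (1 / (K1 * G))) :=
      (le_max_right _ _).trans (le_max_right _ _)
    have h4 : 1 / max 1 (max (K2 * G) (1 / (K1 * G))) ≤ K1 * G := by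
      have := one_div_le_one_div_of_le (by positivity) h3
      rwa [one_div_one_div] at this
    refine h4.trans ?_
    rw [le_div_iff₀ hgG]
    calc K1 * G * (g / G) = K1 * (g / G * G) := by ring
      _ = K1 * g := by rw [hgg]
      _ ≤ _ := e1
  · have h3 : K2 * G ≤ max 1 (max (K2 * G) (1 / (K1 * G))) :=
      (le_max_left _ _).trans (le_max_right _ _)
    refine le_trans ?_ h3
    rw [div_le_iff₀ hgG]
    calc _ ≤ K2 * g := e2
      _ = K2 * (g / G * G) := by rw [hgg]
      _ = K2 * G * (g / G) := by ring

end HarmonicBoundary
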